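/- arXiv:2602.05963 — 2 statements merged into one kernel-verified Lean document; each statement's English description precedes it below -/
import Mathlib

section
/- Let Ω ⊂ ℝ be an open bounded interval, let f satisfy hypothesis (F), and define ρ(ξ) := f'(ξ)/f(ξ) for ξ > 0. Whenever the data satisfy the smooth-data hypothesis (I∞) and ε ∈ (0,1), the classical solution (v_ε,u_ε,Θ_ε) of the regularized problem (P_ε) satisfies, for all t > 0, the identity d/dt {½∫_Ω v_{εx}² + ½∫_Ω u_{εxx}² + ½∫_Ω ρ(Θ_ε)Θ_{εx}²} + ∫_Ω ρ(Θ_ε)Θ_{εxx}² + ε∫_Ω v_{εxxx}² + ε∫_Ω u_{εxxx}² = −½∫_Ω ρ'(Θ_ε)Θ_{εx}²Θ_{εxx} − ∫_Ω ρ(Θ_ε)f'(Θ_ε)Θ_{εx}² v_{εx} − ½∫_Ω ρ'(Θ_ε)f(Θ_ε)Θ_{εx}² v_{εx}. -/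
open MeasureTheory Filter Set Function

noncomputable section

/-- Integral over `Ω = (a,b)`. -/
def intOm (a b : ℝ) (g : ℝ → ℝ) : ℝ := ∫ x in Ioo a b, g x

/-- Double integral over `Ω × (0,T)`. -/
def intOmT (a b T : ℝ) (F : ℝ → ℝ → ℝ) : ℝ :=
  ∫ p in (Ioo a b) ×ˢ (Ioo 0 T), F p.1 p.2

/-- Squared `L²(Ω)` integral of `g`. -/
def sqOm (a b : ℝ) (g : ℝ → ℝ) : ℝ := ∫ x in Ioo a b, (g x) ^ 2

/-- `L²(Ω)` norm. -/
def nrmL2 (a b : ℝ) (g : ℝ → ℝ) : ℝ := (∫ x in Ioo a b, (g x) ^ 2) ^ (1 / 2 : ℝ)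

/-- `L¹(Ω)` norm. -/
def nrmL1 (a b : ℝ) (g : ℝ → ℝ) : ℝ := ∫ x in Ioo a b, |g x|

/-- Membership in `L²(Ω)`. -/
def MemL2 (a b : ℝ) (g : ℝ → ℝ) : Prop :=
  AEStronglyMeasurable g (volume.restrict (Ioo a b)) ∧
    IntegrableOn (fun x => (g x) ^ 2) (Ioo a b)

/-- Zero-trace weak derivative on `(a,b)`: `g ∈ W₀^{1,1}(a,b)` with weak derivative `g'`
(integration by parts against all smooth test functions, with no boundary terms). -/
def WeakDerivZ (a b : ℝ) (g g' : ℝ → ℝ) : Prop :=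
  ∀ ψ : ℝ → ℝ, ContDiff ℝ (⊤ : ℕ∞) ψ →
    ∫ x in Ioo a b, g x * deriv ψ x = - ∫ x in Ioo a b, g' x * ψ x

/-- Interior weak derivative on `(a,b)`: `g ∈ W^{1,1}(a,b)` with weak derivative `g'`. -/
def WeakDerivI (a b : ℝ) (g g' : ℝ → ℝ) : Prop :=
  ∀ ψ : ℝ → ℝ, ContDiff ℝ (⊤ : ℕ∞) ψ → tsupport ψ ⊆ Ioo a b →
    ∫ x in Ioo a b, g x * deriv ψ x = - ∫ x in Ioo a b, g' x * ψ x

/-- Hypothesis (F) on the nonlinearity `f`, where `f'`, `f''` denote its first and second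
derivatives on `[0,∞)`: `f ∈ C²([0,∞))`, `f(0)=0`, `f' > 0` on `[0,∞)`,
and `f' ∈ W^{1,∞}((0,∞))` (i.e. `f'` and `f''` are bounded). -/
structure HypF (f f' f'' : ℝ → ℝ) : Prop where
  hasDeriv₁ : ∀ x ∈ Ici (0 : ℝ), HasDerivWithinAt f (f' x) (Ici 0) x
  hasDeriv₂ : ∀ x ∈ Ici (0 : ℝ), HasDerivWithinAt f' (f'' x) (Ici 0) x
  cont₂ : ContinuousOn f'' (Ici 0)
  zero : f 0 = 0
  pos : ∀ x ∈ Ici (0 : ℝ), 0 < f' x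
  bdd : ∃ M : ℝ, ∀ x ∈ Ici (0 : ℝ), |f' x| ≤ M ∧ |f'' x| ≤ M

/-- Partial derivative in the first (spatial) variable. -/
def pdx (w : ℝ → ℝ → ℝ) : ℝ → ℝ → ℝ := fun x t => deriv (fun y => w y t) x

/-- Partial derivative in the second (time) variable. -/
def pdt (w : ℝ → ℝ → ℝ) : ℝ → ℝ → ℝ := fun x t => deriv (fun s => w x s) t

/-- Test functions in `C₀^∞(Ω × [0,T))`. -/
structure TestU (a b T : ℝ) (φ : ℝ → ℝ → ℝ) : Prop where
  smooth : ContDiff ℝ (⊤ : ℕ∞) (uncurry φ)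
  suppx : ∃ K : Set ℝ, IsCompact K ∧ K ⊆ Ioo a b ∧ ∀ x t, x ∉ K → φ x t = 0
  suppt : ∃ T' : ℝ, T' < T ∧ ∀ x t, T' ≤ t → φ x t = 0

/-- Test functions in `C^∞(Ω̄ × [0,T))`, compactly supported in time. -/
structure TestT (T : ℝ) (φ : ℝ → ℝ → ℝ) : Prop where
  smooth : ContDiff ℝ (⊤ : ℕ∞) (uncurry φ)
  suppt : ∃ T' : ℝ, T' < T ∧ ∀ x t, T' ≤ t → φ x t = 0

/-- Test functions in `C₀^∞(Ω × (0,T))`. -/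
structure TestInt (a b T : ℝ) (φ : ℝ → ℝ → ℝ) : Prop where
  smooth : ContDiff ℝ (⊤ : ℕ∞) (uncurry φ)
  suppx : ∃ K : Set ℝ, IsCompact K ∧ K ⊆ Ioo a b ∧ ∀ x t, x ∉ K → φ x t = 0
  supptime : ∃ K : Set ℝ, IsCompact K ∧ K ⊆ Ioo 0 T ∧ ∀ x t, t ∉ K → φ x t = 0

/-- Definition (W): weak solution of (P) on `Ω × (0,T)`.  Here `ut`, `ux`, `Θx` denote
the weak derivatives of `u` (in time and space) and of `Θ` (in space). -/
structure IsWeakSol (a b T : ℝ) (f f' : ℝ → ℝ) (u0 u0t Θ0 : ℝ → ℝ)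
    (u ut ux Θ Θx : ℝ → ℝ → ℝ) : Prop where
  u_sliceL1 : ∀ t ∈ Icc 0 T, IntegrableOn (fun x => u x t) (Ioo a b)
  u_contL1 : ∀ t₀ ∈ Icc 0 T,
    Tendsto (fun t => ∫ x in Ioo a b, |u x t - u x t₀|) (nhdsWithin t₀ (Icc 0 T)) (nhds 0)
  u_int : IntegrableOn (fun p : ℝ × ℝ => u p.1 p.2) ((Ioo a b) ×ˢ (Ioo 0 T))
  ux_int : IntegrableOn (fun p : ℝ × ℝ => ux p.1 p.2) ((Ioo a b) ×ˢ (Ioo 0 T))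
  u_W0 : ∀ᵐ t ∂volume.restrict (Ioo 0 T), WeakDerivZ a b (fun x => u x t) (fun x => ux x t)
  Θ_int : IntegrableOn (fun p : ℝ × ℝ => Θ p.1 p.2) ((Ioo a b) ×ˢ (Ioo 0 T))
  Θx_int : IntegrableOn (fun p : ℝ × ℝ => Θx p.1 p.2) ((Ioo a b) ×ˢ (Ioo 0 T))
  Θ_W : ∀ᵐ t ∂volume.restrict (Ioo 0 T), WeakDerivI a b (fun x => Θ x t) (fun x => Θx x t)
  Θ_nonneg : ∀ᵐ p ∂volume.restrict ((Ioo a b) ×ˢ (Ioo 0 T)), 0 ≤ Θ p.1 p.2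
  ut_weak : ∀ φ : ℝ → ℝ → ℝ, TestInt a b T φ →
    intOmT a b T (fun x t => u x t * pdt φ x t) = - intOmT a b T (fun x t => ut x t * φ x t)
  ut_int : IntegrableOn (fun p : ℝ × ℝ => ut p.1 p.2) ((Ioo a b) ×ˢ (Ioo 0 T))
  g1_int : IntegrableOn (fun p : ℝ × ℝ => f' (Θ p.1 p.2) * Θx p.1 p.2)
    ((Ioo a b) ×ˢ (Ioo 0 T))
  g2_int : IntegrableOn (fun p : ℝ × ℝ => f' (Θ p.1 p.2) * Θx p.1 p.2 * ut p.1 p.2)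
    ((Ioo a b) ×ˢ (Ioo 0 T))
  g3_int : IntegrableOn (fun p : ℝ × ℝ => f (Θ p.1 p.2) * ut p.1 p.2)
    ((Ioo a b) ×ˢ (Ioo 0 T))
  weak_u : ∀ φ : ℝ → ℝ → ℝ, TestU a b T φ →
    intOmT a b T (fun x t => u x t * pdt (pdt φ) x t)
        - intOm a b (fun x => u0t x * φ x 0) + intOm a b (fun x => u0 x * pdt φ x 0)
      = - intOmT a b T (fun x t => ux x t * pdx φ x t)
        - intOmT a b T (fun x t => f' (Θ x t) * Θx x t * φ x t)
  weak_Θ : ∀ φ : ℝ → ℝ → ℝ, TestT T φ →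
    - intOmT a b T (fun x t => Θ x t * pdt φ x t) - intOm a b (fun x => Θ0 x * φ x 0)
      = - intOmT a b T (fun x t => Θx x t * pdx φ x t)
        + intOmT a b T (fun x t => f' (Θ x t) * Θx x t * ut x t * φ x t)
        + intOmT a b T (fun x t => f (Θ x t) * ut x t * pdx φ x t)

/-- Continuity of `t ↦ w(·,t)` as a map `J → L²(Ω)` (with slices in `L²(Ω)`). -/
def ContL2 (a b : ℝ) (J : Set ℝ) (w : ℝ → ℝ → ℝ) : Prop :=
  (∀ t ∈ J, MemL2 a b (fun x => w x t)) ∧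
    ∀ t₀ ∈ J, Tendsto (fun t => ∫ x in Ioo a b, (w x t - w x t₀) ^ 2)
      (nhdsWithin t₀ J) (nhds 0)

/-- The regularity class (R_T):  `u ∈ C⁰([0,T];W₀^{1,2})`, `u_t ∈ C⁰([0,T];L²)`,
`Θ ∈ C⁰([0,T];L²) ∩ L²((0,T);W^{1,2})`. -/
structure RegT (a b T : ℝ) (u ut ux Θ Θx : ℝ → ℝ → ℝ) : Prop where
  u_cont : ContL2 a b (Icc 0 T) u
  ux_cont : ContL2 a b (Icc 0 T) ux
  u_W0 : ∀ t ∈ Icc (0 : ℝ) T, WeakDerivZ a b (fun x => u x t) (fun x => ux x t)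
  ut_cont : ContL2 a b (Icc 0 T) ut
  Θ_cont : ContL2 a b (Icc 0 T) Θ
  Θ_sq_int : IntegrableOn (fun p : ℝ × ℝ => (Θ p.1 p.2) ^ 2) ((Ioo a b) ×ˢ (Ioo 0 T))
  Θx_sq_int : IntegrableOn (fun p : ℝ × ℝ => (Θx p.1 p.2) ^ 2) ((Ioo a b) ×ˢ (Ioo 0 T))

/-- Data hypothesis (I), with `u0x` the weak derivative of `u0 ∈ W₀^{1,2}(Ω)`. -/
structure DataI (a b : ℝ) (u0 u0x u0t Θ0 : ℝ → ℝ) : Prop where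
  u0_L2 : MemL2 a b u0
  u0x_L2 : MemL2 a b u0x
  u0_W0 : WeakDerivZ a b u0 u0x
  u0t_L2 : MemL2 a b u0t
  Θ0_L2 : MemL2 a b Θ0
  Θ0_nonneg : ∀ᵐ x ∂volume.restrict (Ioo a b), 0 ≤ Θ0 x

/-- Smooth-data hypothesis (I∞). -/
structure SmoothData (a b : ℝ) (v0 u0 Θ0 : ℝ → ℝ) : Prop where
  v0_smooth : ContDiff ℝ (⊤ : ℕ∞) v0
  v0_supp : ∃ K : Set ℝ, IsCompact K ∧ K ⊆ Ioo a b ∧ ∀ x, x ∉ K → v0 x = 0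
  u0_smooth : ContDiff ℝ (⊤ : ℕ∞) u0
  u0_supp : ∃ K : Set ℝ, IsCompact K ∧ K ⊆ Ioo a b ∧ ∀ x, x ∉ K → u0 x = 0
  Θ0_smooth : ContDiff ℝ (⊤ : ℕ∞) Θ0
  Θ0_pos : ∀ x ∈ Icc a b, 0 < Θ0 x
  Θ0x_supp : ∃ K : Set ℝ, IsCompact K ∧ K ⊆ Ioo a b ∧ ∀ x, x ∉ K → deriv Θ0 x = 0

/-- Classical solution of the regularized problem (P_ε), of class
`C^{4,1} × C^{2,1} × C^{2,1}(Ω̄ × [0,∞))`, with positive temperature. -/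
structure IsClassicalSolEps (a b : ℝ) (f : ℝ → ℝ) (ε : ℝ) (v0 u0 Θ0 : ℝ → ℝ)
    (v u Θ : ℝ → ℝ → ℝ) : Prop where
  diffx_v : ∀ k < 4, ∀ x ∈ Icc a b, ∀ t ∈ Ici (0 : ℝ),
    DifferentiableAt ℝ (fun y => pdx^[k] v y t) x
  difft_v : ∀ x ∈ Icc a b, ∀ t ∈ Ici (0 : ℝ), DifferentiableAt ℝ (fun s => v x s) t
  cont_v : ∀ k ≤ 4, ContinuousOn (uncurry (pdx^[k] v)) ((Icc a b) ×ˢ (Ici 0))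
  contt_v : ContinuousOn (uncurry (pdt v)) ((Icc a b) ×ˢ (Ici 0))
  diffx_u : ∀ k < 2, ∀ x ∈ Icc a b, ∀ t ∈ Ici (0 : ℝ),
    DifferentiableAt ℝ (fun y => pdx^[k] u y t) x
  difft_u : ∀ x ∈ Icc a b, ∀ t ∈ Ici (0 : ℝ), DifferentiableAt ℝ (fun s => u x s) t
  cont_u : ∀ k ≤ 2, ContinuousOn (uncurry (pdx^[k] u)) ((Icc a b) ×ˢ (Ici 0))
  contt_u : ContinuousOn (uncurry (pdt u)) ((Icc a b) ×ˢ (Ici 0))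
  diffx_Θ : ∀ k < 2, ∀ x ∈ Icc a b, ∀ t ∈ Ici (0 : ℝ),
    DifferentiableAt ℝ (fun y => pdx^[k] Θ y t) x
  difft_Θ : ∀ x ∈ Icc a b, ∀ t ∈ Ici (0 : ℝ), DifferentiableAt ℝ (fun s => Θ x s) t
  cont_Θ : ∀ k ≤ 2, ContinuousOn (uncurry (pdx^[k] Θ)) ((Icc a b) ×ˢ (Ici 0))
  contt_Θ : ContinuousOn (uncurry (pdt Θ)) ((Icc a b) ×ˢ (Ici 0))
  Θ_pos : ∀ x ∈ Icc a b, ∀ t ∈ Ici (0 : ℝ), 0 < Θ x t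
  eq_v : ∀ x ∈ Ioo a b, ∀ t ∈ Ioi (0 : ℝ),
    pdt v x t = -ε * pdx^[4] v x t + pdx^[2] u x t - pdx (fun y s => f (Θ y s)) x t
  eq_u : ∀ x ∈ Ioo a b, ∀ t ∈ Ioi (0 : ℝ), pdt u x t = ε * pdx^[2] u x t + v x t
  eq_Θ : ∀ x ∈ Ioo a b, ∀ t ∈ Ioi (0 : ℝ),
    pdt Θ x t = pdx^[2] Θ x t - f (Θ x t) * pdx v x t
  bc_v : ∀ t ∈ Ioi (0 : ℝ),
    v a t = 0 ∧ v b t = 0 ∧ pdx^[2] v a t = 0 ∧ pdx^[2] v b t = 0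
  bc_u : ∀ t ∈ Ioi (0 : ℝ), u a t = 0 ∧ u b t = 0
  bc_Θ : ∀ t ∈ Ioi (0 : ℝ), pdx Θ a t = 0 ∧ pdx Θ b t = 0
  init : ∀ x ∈ Icc a b, v x 0 = v0 x ∧ u x 0 = u0 x ∧ Θ x 0 = Θ0 x

/-- Weak convergence in `L²_loc(Ω̄ × [0,∞))`. -/
def WkL2loc (a b : ℝ) (wj : ℕ → ℝ → ℝ → ℝ) (w : ℝ → ℝ → ℝ) : Prop :=
  ∀ T > (0 : ℝ), ∀ ψ : ℝ → ℝ → ℝ,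
    AEStronglyMeasurable (fun p : ℝ × ℝ => ψ p.1 p.2)
      (volume.restrict ((Icc a b) ×ˢ (Icc 0 T))) →
    IntegrableOn (fun p : ℝ × ℝ => (ψ p.1 p.2) ^ 2) ((Icc a b) ×ˢ (Icc 0 T)) →
    Tendsto (fun j => ∫ p in (Icc a b) ×ˢ (Icc 0 T), wj j p.1 p.2 * ψ p.1 p.2) atTop
      (nhds (∫ p in (Icc a b) ×ˢ (Icc 0 T), w p.1 p.2 * ψ p.1 p.2))

/-- Symmetric difference-quotient principle: if the increments of `F` are
`∫ (w(s) - w(t)) (g(s) + g(t))`, then `F' = 2 ∫ w_t g`, without differentiability of `g` in time. -/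
theorem hasDerivAt_of_sub_eq_integral {a b t t₁ t₂ : ℝ} (hab : a ≤ b) (ht : t ∈ Ioo t₁ t₂)
    {F : ℝ → ℝ} {w wt g : ℝ → ℝ → ℝ}
    (hw : ∀ x ∈ Icc a b, ∀ s ∈ Icc t₁ t₂, HasDerivAt (w x) (wt x s) s)
    (hwc : ∀ s ∈ Icc t₁ t₂, ContinuousOn (fun x => w x s) (Icc a b))
    (hwt : ContinuousOn (uncurry wt) (Icc a b ×ˢ Icc t₁ t₂))
    (hg : ContinuousOn (uncurry g) (Icc a b ×ˢ Icc t₁ t₂))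
    (hF : ∀ s ∈ Icc t₁ t₂, F s - F t = ∫ x in a..b, (w x s - w x t) * (g x s + g x t)) :
    HasDerivAt F (2 * ∫ x in a..b, wt x t * g x t) t := by
  have htI : t ∈ Icc t₁ t₂ := Ioo_subset_Icc_self ht
  have hK : IsCompact (Icc a b ×ˢ Icc t₁ t₂) := isCompact_Icc.prod isCompact_Icc
  obtain ⟨M, hM⟩ := hK.exists_bound_of_continuousOn hwt
  obtain ⟨N, hN⟩ := hK.exists_bound_of_continuousOn hg
  have hnear : ∀ᶠ s in nhdsWithin t {t}ᶜ, s ∈ Icc t₁ t₂ :=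
    mem_nhdsWithin_of_mem_nhds (Icc_mem_nhds ht.1 ht.2)
  have hgx : ∀ s ∈ Icc t₁ t₂, ContinuousOn (fun x => g x s) (Icc a b) := fun s hs =>
    hg.comp (f := fun x => (x, s)) (by fun_prop) (fun x hx => ⟨hx, hs⟩)
  have hgt : ∀ x ∈ Icc a b, ContinuousOn (g x) (Icc t₁ t₂) := fun x hx =>
    hg.comp (f := fun s => (x, s)) (by fun_prop) (fun s hs => ⟨hx, hs⟩)
  rw [hasDerivAt_iff_tendsto_slope, ← intervalIntegral.integral_const_mul]
  have hlim : Tendsto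
      (fun s => ∫ x in a..b, slope (w x) t s * (g x s + g x t)) (nhdsWithin t {t}ᶜ)
      (nhds (∫ x in a..b, 2 * (wt x t * g x t))) := by
    apply intervalIntegral.tendsto_integral_filter_of_dominated_convergence
      (fun _ => M * (N + N))
    · filter_upwards [hnear] with s hs
      refine ContinuousOn.aestronglyMeasurable ?_ measurableSet_uIoc
      rw [uIoc_of_le hab]
      refine ContinuousOn.mono ?_ Ioc_subset_Icc_self
      simp only [slope_def_field]
      exact (((hwc s hs).sub (hwc t htI)).div_const _).mul ((hgx s hs).add (hgx t htI))
    · filter_upwards [hnear, self_mem_nhdsWithin] with s hs hst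
      refine Eventually.of_forall fun x hx => ?_
      rw [uIoc_of_le hab] at hx
      have hx' := Ioc_subset_Icc_self hx
      have h1 : ‖w x s - w x t‖ ≤ M * ‖s - t‖ :=
        Convex.norm_image_sub_le_of_norm_hasDerivWithin_le (s := Icc t₁ t₂)
          (fun r hr => (hw x hx' r hr).hasDerivWithinAt) (fun r hr => hM (x, r) ⟨hx', hr⟩)
          (convex_Icc _ _) htI hs
      have h0 : 0 < ‖s - t‖ := norm_pos_iff.2 (sub_ne_zero.2 hst)
      have h2 : ‖slope (w x) t s‖ ≤ M := by
        rw [slope_def_field, norm_div, div_le_iff₀ h0]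
        exact h1
      rw [norm_mul]
      exact mul_le_mul h2 ((norm_add_le _ _).trans
        (add_le_add (hN (x, s) ⟨hx', hs⟩) (hN (x, t) ⟨hx', htI⟩))) (norm_nonneg _)
        ((norm_nonneg _).trans h2)
    · exact intervalIntegrable_const
    · refine Eventually.of_forall fun x hx => ?_
      rw [uIoc_of_le hab] at hx
      have hx' := Ioc_subset_Icc_self hx
      have h1 := hasDerivAt_iff_tendsto_slope.1 (hw x hx' t htI)
      have h2 : Tendsto (g x) (nhdsWithin t {t}ᶜ) (nhds (g x t)) :=
        ((hgt x hx').continuousAt (Icc_mem_nhds ht.1 ht.2)).tendsto.mono_left nhdsWithin_le_nhds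
      have h3 := h1.mul (h2.add_const (g x t))
      convert h3 using 2
      ring
  refine hlim.congr' ?_
  filter_upwards [hnear] with s hs
  rw [slope_def_field, hF s hs, div_eq_mul_inv, mul_comm, ← intervalIntegral.integral_const_mul]
  refine intervalIntegral.integral_congr fun x _ => ?_
  simp only [slope_def_field]
  ring

/-- Integration by parts with vanishing boundary contributions. -/
theorem integral_deriv_mul_eq_neg {a b : ℝ} (hab : a ≤ b) {p p' q q' : ℝ → ℝ}
    (hp : ∀ x ∈ Icc a b, HasDerivAt p (p' x) x) (hq : ∀ x ∈ Icc a b, HasDerivAt q (q' x) x)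
    (hp' : ContinuousOn p' (Icc a b)) (hq' : ContinuousOn q' (Icc a b))
    (ha : p a * q a = 0) (hb : p b * q b = 0) :
    ∫ x in a..b, p' x * q x = -∫ x in a..b, p x * q' x := by
  rw [← uIcc_of_le hab] at hp hq hp' hq'
  have h := intervalIntegral.integral_mul_deriv_eq_deriv_mul hp hq hp'.intervalIntegrable
    hq'.intervalIntegrable
  rw [h, ha, hb]
  ring

/-- Green's second identity on an interval for functions vanishing at the endpoints. -/
theorem integral_deriv2_mul_eq {a b : ℝ} (hab : a ≤ b) {p p' p'' q q' q'' : ℝ → ℝ}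
    (hp : ∀ x ∈ Icc a b, HasDerivAt p (p' x) x) (hp' : ∀ x ∈ Icc a b, HasDerivAt p' (p'' x) x)
    (hp'' : ContinuousOn p'' (Icc a b))
    (hq : ∀ x ∈ Icc a b, HasDerivAt q (q' x) x) (hq' : ∀ x ∈ Icc a b, HasDerivAt q' (q'' x) x)
    (hq'' : ContinuousOn q'' (Icc a b))
    (hpa : p a = 0) (hpb : p b = 0) (hqa : q a = 0) (hqb : q b = 0) :
    ∫ x in a..b, p'' x * q x = ∫ x in a..b, p x * q'' x := by
  have hcp' : ContinuousOn p' (Icc a b) := fun x hx => (hp' x hx).continuousAt.continuousWithinAt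
  have hcq' : ContinuousOn q' (Icc a b) := fun x hx => (hq' x hx).continuousAt.continuousWithinAt
  rw [integral_deriv_mul_eq_neg hab hp' hq hp'' hcq' (by simp [hqa]) (by simp [hqb]),
    integral_deriv_mul_eq_neg hab hp hq' hcp' hq'' (by simp [hpa]) (by simp [hpb]), neg_neg]

/-- Derivative in time of `∫ w_x²`, requiring no mixed derivative `w_{xt}`. -/
theorem hasDerivAt_integral_deriv_sq {a b t t₁ t₂ : ℝ} (hab : a ≤ b) (ht : t ∈ Ioo t₁ t₂)
    {w wt wx wxx : ℝ → ℝ → ℝ}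
    (hw : ∀ x ∈ Icc a b, ∀ s ∈ Icc t₁ t₂, HasDerivAt (w x) (wt x s) s)
    (hwx : ∀ x ∈ Icc a b, ∀ s ∈ Icc t₁ t₂, HasDerivAt (fun y => w y s) (wx x s) x)
    (hwxx : ∀ x ∈ Icc a b, ∀ s ∈ Icc t₁ t₂, HasDerivAt (fun y => wx y s) (wxx x s) x)
    (hwt : ContinuousOn (uncurry wt) (Icc a b ×ˢ Icc t₁ t₂))
    (hwxxc : ContinuousOn (uncurry wxx) (Icc a b ×ˢ Icc t₁ t₂))
    (hbd : ∀ s ∈ Icc t₁ t₂, (w a s - w a t) * (wx a s + wx a t) = 0 ∧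
      (w b s - w b t) * (wx b s + wx b t) = 0) :
    HasDerivAt (fun s => ∫ x in a..b, (wx x s) ^ 2) (-2 * ∫ x in a..b, wt x t * wxx x t) t := by
  have htI : t ∈ Icc t₁ t₂ := Ioo_subset_Icc_self ht
  have hwxc : ∀ s ∈ Icc t₁ t₂, ContinuousOn (fun x => wx x s) (Icc a b) :=
    fun s hs x hx => (hwxx x hx s hs).continuousAt.continuousWithinAt
  have hwxxs : ∀ s ∈ Icc t₁ t₂, ContinuousOn (fun x => wxx x s) (Icc a b) := fun s hs =>
    hwxxc.comp (f := fun x => (x, s)) (by fun_prop) (fun x hx => ⟨hx, hs⟩)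
  have key := hasDerivAt_of_sub_eq_integral hab ht (g := fun x s => -wxx x s)
    (F := fun s => ∫ x in a..b, (wx x s) ^ 2) hw
    (fun s hs x hx => (hwx x hx s hs).continuousAt.continuousWithinAt) hwt hwxxc.neg ?_
  · convert key using 1
    simp only [mul_neg, intervalIntegral.integral_neg]
    ring
  · intro s hs
    have hI : ∀ r ∈ Icc t₁ t₂, IntervalIntegrable (fun x => (wx x r) ^ 2) volume a b :=
      fun r hr => ContinuousOn.intervalIntegrable_of_Icc hab ((hwxc r hr).pow 2)
    rw [← intervalIntegral.integral_sub (hI s hs) (hI t htI)]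
    have h := integral_deriv_mul_eq_neg hab (p := fun x => w x s - w x t)
      (q := fun x => wx x s + wx x t)
      (fun x hx => (hwx x hx s hs).sub (hwx x hx t htI))
      (fun x hx => (hwxx x hx s hs).add (hwxx x hx t htI))
      ((hwxc s hs).sub (hwxc t htI)) ((hwxxs s hs).add (hwxxs t htI)) (hbd s hs).1 (hbd s hs).2
    rw [← intervalIntegral.integral_neg] at h
    calc _ = ∫ x in a..b, (wx x s - wx x t) * (wx x s + wx x t) :=
          intervalIntegral.integral_congr fun x _ => by ring
      _ = _ := h
      _ = _ := intervalIntegral.integral_congr fun x _ => by ring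

theorem abs_le_of_hasDerivAt_linear {y g : ℝ → ℝ} {μ G τ s : ℝ} (hμ : 0 < μ) (hτ : τ ≤ s)
    (hy : ∀ r ∈ Icc τ s, HasDerivAt y (-μ * y r + g r) r) (hg : ∀ r ∈ Icc τ s, |g r| ≤ G) :
    |y s| ≤ Real.exp (-(μ * (s - τ))) * |y τ| + G / μ := by
  have hG : 0 ≤ G := (abs_nonneg _).trans (hg τ ⟨le_rfl, hτ⟩)
  have main : ∀ z h : ℝ → ℝ, (∀ r ∈ Icc τ s, HasDerivAt z (-μ * z r + h r) r) →
      (∀ r ∈ Icc τ s, h r ≤ G) →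
      z s ≤ Real.exp (-(μ * (s - τ))) * |z τ| + G / μ := by
    intro z h hz hh
    have hd : ∀ r ∈ Icc τ s, HasDerivAt (fun r => Real.exp (μ * (r - τ)) * (z r - G / μ))
        (Real.exp (μ * (r - τ)) * (h r - G)) r := by
      intro r hr
      have h1 : HasDerivAt (fun r => Real.exp (μ * (r - τ))) (Real.exp (μ * (r - τ)) * (μ * 1)) r :=
        (((hasDerivAt_id r).sub_const τ).const_mul μ).exp
      refine (h1.mul ((hz r hr).sub_const (G / μ))).congr_deriv ?_
      field_simp
      ring
    have hanti : AntitoneOn (fun r => Real.exp (μ * (r - τ)) * (z r - G / μ)) (Icc τ s) := by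
      apply antitoneOn_of_deriv_nonpos (convex_Icc _ _)
      · exact fun r hr => (hd r hr).continuousAt.continuousWithinAt
      · intro r hr
        exact (hd r (interior_subset hr)).differentiableAt.differentiableWithinAt
      · intro r hr
        rw [(hd r (interior_subset hr)).deriv]
        exact mul_nonpos_of_nonneg_of_nonpos (Real.exp_pos _).le
          (sub_nonpos.2 (hh r (interior_subset hr)))
    have h1 := hanti ⟨le_rfl, hτ⟩ ⟨hτ, le_rfl⟩ hτ
    simp only [sub_self, mul_zero, Real.exp_zero, one_mul] at h1
    have h2 : z s - G / μ ≤ Real.exp (-(μ * (s - τ))) * (z τ - G / μ) := by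
      rw [Real.exp_neg, ← div_eq_inv_mul, le_div_iff₀ (Real.exp_pos _), mul_comm]
      exact h1
    have h3 : Real.exp (-(μ * (s - τ))) * (z τ - G / μ) ≤ Real.exp (-(μ * (s - τ))) * |z τ| := by
      refine mul_le_mul_of_nonneg_left ?_ (Real.exp_pos _).le
      have := le_abs_self (z τ)
      have : 0 ≤ G / μ := by positivity
      linarith
    linarith
  rw [abs_le']
  refine ⟨main y g hy fun r hr => (abs_le.1 (hg r hr)).2, ?_⟩
  have h := main (fun r => -y r) (fun r => -g r) (fun r hr =>
    (hy r hr).neg.congr_deriv (by ring)) (fun r hr => by linarith [(abs_le.1 (hg r hr)).1])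
  simpa using h

/-- Frequencies of the Dirichlet sine system on `(a,b)`. -/
def sineFreq (a b : ℝ) (n : ℕ) : ℝ := n * Real.pi / (b - a)

/-- Unnormalized sine coefficients on `(a,b)`. -/
def sineCoeff (a b : ℝ) (p : ℝ → ℝ) (n : ℕ) : ℝ :=
  ∫ x in a..b, p x * Real.sin (sineFreq a b n * (x - a))

theorem sineFreq_mul_sub {a b : ℝ} (hab : a < b) (n : ℕ) :
    sineFreq a b n * (b - a) = n * Real.pi := by
  have : b - a ≠ 0 := (sub_pos.2 hab).ne'
  unfold sineFreq
  field_simp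

theorem sineCoeff_deriv2 {a b : ℝ} (hab : a < b) {p p' p'' : ℝ → ℝ}
    (hp : ∀ x ∈ Icc a b, HasDerivAt p (p' x) x) (hp' : ∀ x ∈ Icc a b, HasDerivAt p' (p'' x) x)
    (hp'' : ContinuousOn p'' (Icc a b)) (hpa : p a = 0) (hpb : p b = 0) (n : ℕ) :
    sineCoeff a b p'' n = -(sineFreq a b n) ^ 2 * sineCoeff a b p n := by
  set k := sineFreq a b n with hk
  have hlin : ∀ x : ℝ, HasDerivAt (fun x => k * (x - a)) k x := fun x => by
    simpa using ((hasDerivAt_id x).sub_const a).const_mul k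
  have h := integral_deriv2_mul_eq hab.le (q := fun x => Real.sin (k * (x - a)))
    (q' := fun x => Real.cos (k * (x - a)) * k) (q'' := fun x => -Real.sin (k * (x - a)) * k * k)
    hp hp' hp'' (fun x _ => (hlin x).sin) (fun x _ => (hlin x).cos.mul_const k)
    (by fun_prop) hpa hpb (by simp) (by simp [hk, sineFreq_mul_sub hab, Real.sin_nat_mul_pi])
  unfold sineCoeff
  rw [h, ← intervalIntegral.integral_const_mul]
  exact intervalIntegral.integral_congr fun x _ => by ring

theorem abs_sineCoeff_le {a b M : ℝ} (hab : a ≤ b) {p : ℝ → ℝ} (hM : ∀ x ∈ Icc a b, |p x| ≤ M)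
    (n : ℕ) : |sineCoeff a b p n| ≤ M * (b - a) := by
  have h := intervalIntegral.norm_integral_le_of_norm_le_const (a := a) (b := b) (C := M)
    (f := fun x => p x * Real.sin (sineFreq a b n * (x - a))) ?_
  · rwa [abs_of_nonneg (sub_nonneg.2 hab)] at h
  · intro x hx
    rw [uIoc_of_le hab] at hx
    rw [norm_mul]
    calc _ ≤ |p x| * 1 := mul_le_mul_of_nonneg_left (Real.abs_sin_le_one _) (abs_nonneg _)
      _ ≤ M := by rw [mul_one]; exact hM x (Ioc_subset_Icc_self hx)

/-- Pointwise convergence of the sine series of a continuous function vanishing at the endpoints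
whose coefficients are summable. -/
theorem hasSum_sineCoeff {a b : ℝ} (hab : a < b) {p : ℝ → ℝ} (hp : ContinuousOn p (Icc a b))
    (hpa : p a = 0) (hpb : p b = 0) (hs : Summable (sineCoeff a b p)) {x : ℝ} (hx : x ∈ Icc a b) :
    HasSum (fun n => 2 / (b - a) * sineCoeff a b p n * Real.sin (sineFreq a b n * (x - a)))
      (p x) := by
  set L := b - a with hL
  have hL0 : 0 < L := sub_pos.2 hab
  have hT : Fact (0 < 2 * L) := ⟨by positivity⟩
  let P : ℝ → ℂ := fun y => (p (a + max y 0) : ℂ) - (p (a + max (-y) 0) : ℂ)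
  have hPpos : ∀ y, 0 ≤ y → P y = p (a + y) := fun y hy => by
    simp [P, hy, hpa]
  have hPneg : ∀ y, 0 ≤ y → P (-y) = -p (a + y) := fun y hy => by
    simp [P, hy, hpa]
  have hend : -L + 2 * L = L := by ring
  have hPc : ContinuousOn P (Icc (-L) (-L + 2 * L)) := by
    rw [hend]
    refine ContinuousOn.sub ?_ ?_
    · refine Complex.continuous_ofReal.comp_continuousOn (hp.comp (by fun_prop) ?_)
      intro y hy
      exact ⟨by linarith [le_max_right y 0], by linarith [max_le hy.2 hL0.le]⟩
    · refine Complex.continuous_ofReal.comp_continuousOn (hp.comp (by fun_prop) ?_)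
      intro y hy
      exact ⟨by linarith [le_max_right (-y) 0], by linarith [max_le (neg_le.1 hy.1) hL0.le]⟩
  have hper : P (-L) = P (-L + 2 * L) := by
    rw [hend, hPpos L hL0.le, hPneg L hL0.le]
    simp [hL, hpb]
  let f : C(AddCircle (2 * L), ℂ) :=
    ⟨AddCircle.liftIco (2 * L) (-L) P, AddCircle.liftIco_continuous hper hPc⟩
  have hfP : ∀ y ∈ Ico (-L) L, f (y : AddCircle (2 * L)) = P y := fun y hy =>
    AddCircle.liftIco_coe_apply (f := P) (a := -L) (by rwa [hend])
  have hexp : ∀ (n : ℤ) (y : ℝ), (fourier n (y : AddCircle (2 * L)) : ℂ)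
      = Complex.cos (n * Real.pi / L * y) + Complex.sin (n * Real.pi / L * y) * Complex.I := by
    intro n y
    rw [fourier_coe_apply, ← Complex.exp_mul_I]
    congr 1
    have : (L : ℂ) ≠ 0 := by exact_mod_cast hL0.ne'
    push_cast
    field_simp
  have hcoef : ∀ n : ℤ, fourierCoeff f n
      = (1 / (2 * L) : ℂ) * ∫ y in (0 : ℝ)..L,
        (p (a + y) : ℂ) * (-2 * Complex.I * Complex.sin (n * Real.pi / L * y)) := by
    intro n
    have h0 : fourierCoeff f n
        = (1 / (2 * L)) • ∫ y in (-L)..L, fourier (-n) (y : AddCircle (2 * L)) • P y := by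
      rw [fourierCoeff_eq_intervalIntegral _ _ (-L), hend]
      congr 1
      refine intervalIntegral.integral_congr_Ioo_of_le (by linarith) fun y hy => ?_
      simp only [hfP y (Ioo_subset_Ico_self hy)]
    have hc : ContinuousOn (fun y : ℝ => (fourier (-n) (y : AddCircle (2 * L)) : ℂ) • P y)
        (Icc (-L) L) := by
      rw [hend] at hPc
      simp only [hexp, smul_eq_mul]
      refine ContinuousOn.mul ?_ hPc
      fun_prop
    have hi : ∀ c d, c ∈ Icc (-L) L → d ∈ Icc (-L) L → IntervalIntegrable
        (fun y : ℝ => (fourier (-n) (y : AddCircle (2 * L)) : ℂ) • P y) volume c d :=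
      fun c d h1 h2 => (hc.mono (Icc_subset_Icc (le_min h1.1 h2.1)
        (max_le h1.2 h2.2))).intervalIntegrable
    have hm1 : -L ∈ Icc (-L) L := ⟨le_rfl, by linarith⟩
    have hm0 : (0 : ℝ) ∈ Icc (-L) L := ⟨by linarith, hL0.le⟩
    have hm2 : L ∈ Icc (-L) L := ⟨by linarith, le_rfl⟩
    have hreflect := intervalIntegral.integral_comp_neg (a := 0) (b := L)
      (fun y : ℝ => (fourier (-n) (y : AddCircle (2 * L)) : ℂ) • P y)
    rw [neg_zero] at hreflect
    have hi' : IntervalIntegrable (fun y : ℝ => (fourier (-n) ((-y : ℝ) : AddCircle (2 * L)) : ℂ)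
        • P (-y)) volume 0 L := by
      have := (hi _ _ hm1 hm0).comp_sub_left 0
      simpa using this.symm
    rw [h0, ← intervalIntegral.integral_add_adjacent_intervals (hi _ _ hm1 hm0) (hi _ _ hm0 hm2),
      ← hreflect, ← intervalIntegral.integral_add hi' (hi _ _ hm0 hm2), Complex.real_smul]
    congr 1
    · push_cast; rfl
    refine intervalIntegral.integral_congr fun y hy => ?_
    rw [uIcc_of_le hL0.le] at hy
    simp only [hexp, hPpos y hy.1, hPneg y hy.1, smul_eq_mul]
    push_cast
    have e1 : (-(n : ℂ) * Real.pi / L * -y) = n * Real.pi / L * y := by ring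
    have e2 : (-(n : ℂ) * Real.pi / L * y) = -(n * Real.pi / L * y) := by ring
    rw [e1, e2, Complex.cos_neg, Complex.sin_neg]
    ring
  have hcoefNat : ∀ n : ℕ, fourierCoeff f (n : ℤ)
      = -Complex.I / L * (sineCoeff a b p n : ℂ) := by
    intro n
    rw [hcoef]
    have h1 : sineCoeff a b p n
        = ∫ y in (0 : ℝ)..L, p (a + y) * Real.sin (n * Real.pi / L * y) := by
      unfold sineCoeff sineFreq
      have := intervalIntegral.integral_comp_add_left (a := 0) (b := L)
        (fun x => p x * Real.sin (n * Real.pi / (b - a) * (x - a))) a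
      rw [show a + L = b by rw [hL]; ring, add_zero] at this
      rw [← this]
      exact intervalIntegral.integral_congr fun y _ => by simp [hL]
    rw [h1, ← intervalIntegral.integral_ofReal]
    simp_rw [show ∀ y : ℝ, (p (a + y) : ℂ) * (-2 * Complex.I
      * Complex.sin (((n : ℤ) : ℂ) * Real.pi / L * y))
      = -2 * Complex.I * ((p (a + y) * Real.sin (n * Real.pi / L * y) : ℝ) : ℂ) from
        fun y => by push_cast; ring]
    rw [intervalIntegral.integral_const_mul]
    generalize (∫ y in (0 : ℝ)..L, ((p (a + y) * Real.sin (n * Real.pi / L * y) : ℝ) : ℂ)) = J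
    have : (L : ℂ) ≠ 0 := by exact_mod_cast hL0.ne'
    field_simp
  have hcoefNeg : ∀ n : ℤ, fourierCoeff f (-n) = -fourierCoeff f n := by
    intro n
    rw [hcoef, hcoef, ← mul_neg, ← intervalIntegral.integral_neg]
    congr 1
    refine intervalIntegral.integral_congr fun y _ => ?_
    have e : (((-n : ℤ) : ℂ) * Real.pi / L * y) = -(n * Real.pi / L * y) := by push_cast; ring
    simp only [e, Complex.sin_neg]
    ring
  have hsN : Summable (fun n : ℕ => fourierCoeff f (n : ℤ)) := by
    simp_rw [hcoefNat]
    exact (Complex.ofRealCLM.summable hs).mul_left _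
  have hsZ : Summable (fourierCoeff f) := by
    refine Summable.of_nat_of_neg hsN ?_
    simp_rw [hcoefNeg]
    exact hsN.neg
  have hsum := (has_pointwise_sum_fourier_series_of_summable hsZ
    ((x - a : ℝ) : AddCircle (2 * L))).nat_add_neg
  have hzero : fourierCoeff f 0 = 0 := by
    have := hcoefNeg 0
    rw [neg_zero] at this
    exact self_eq_neg.1 this
  have hfx : f ((x - a : ℝ) : AddCircle (2 * L)) = p x := by
    have hxa : 0 ≤ x - a := sub_nonneg.2 hx.1
    rcases hx.2.lt_or_eq with h | h
    · rw [hfP _ ⟨by linarith, by linarith⟩, hPpos _ hxa]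
      simp
    · have e : ((x - a : ℝ) : AddCircle (2 * L)) = ((-L : ℝ) : AddCircle (2 * L)) := by
        rw [← AddCircle.coe_add_period (2 * L) (-L), hend, h]
      rw [e, hfP _ ⟨le_rfl, by linarith⟩, hPneg L hL0.le, h]
      simp [hL, hpb]
  rw [hfx, hzero, zero_smul, add_zero] at hsum
  rw [← Complex.hasSum_ofReal]
  convert! hsum using 2 with n
  rw [hcoefNeg, hcoefNat, hexp, hexp]
  have e : (((-n : ℤ) : ℂ) * Real.pi / L * ((x - a : ℝ) : ℂ))
      = -(n * Real.pi / L * ((x - a : ℝ) : ℂ)) := by push_cast; ring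
  simp only [e, Complex.sin_neg, Complex.cos_neg, smul_eq_mul]
  have : (L : ℂ) ≠ 0 := by exact_mod_cast hL0.ne'
  rw [sineFreq, ← hL]
  push_cast
  field_simp
  ring_nf
  rw [Complex.I_sq]
  ring

/-- The `j`-th derivative of the sine series with unnormalized coefficients `c`. -/
def sineSeries (a b : ℝ) (c : ℕ → ℝ) (j : ℕ) (x : ℝ) : ℝ :=
  ∑' n, 2 / (b - a) * c n * sineFreq a b n ^ j
    * Real.sin (sineFreq a b n * (x - a) + j * (Real.pi / 2))

theorem abs_sineSeries_term_le {a b C : ℝ} (hab : a < b) {c : ℕ → ℝ}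
    (hc : ∀ n, |c n| ≤ C / (n : ℝ) ^ 6) {j : ℕ} (hj : j ≤ 4) (θ : ℝ) (n : ℕ) :
    |2 / (b - a) * c n * sineFreq a b n ^ j * Real.sin θ|
      ≤ 2 / (b - a) * C * (Real.pi / (b - a)) ^ j * (1 / (n : ℝ) ^ 2) := by
  have hL : 0 < b - a := sub_pos.2 hab
  have hκ : 0 < Real.pi / (b - a) := div_pos Real.pi_pos hL
  rcases Nat.eq_zero_or_pos n with rfl | hn
  · have : c 0 = 0 := by simpa using hc 0
    simp [this]
  have hn1 : (1 : ℝ) ≤ n := by exact_mod_cast hn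
  have hC : 0 ≤ C := by
    have := (abs_nonneg _).trans (hc n)
    have h6 : (0 : ℝ) < (n : ℝ) ^ 6 := by positivity
    have := mul_nonneg this h6.le
    rwa [div_mul_cancel₀ _ h6.ne'] at this
  have hk : sineFreq a b n = n * (Real.pi / (b - a)) := by unfold sineFreq; ring
  have hsin := Real.abs_sin_le_one θ
  have hnj : (n : ℝ) ^ j ≤ (n : ℝ) ^ 4 := pow_le_pow_right₀ hn1 hj
  rw [abs_mul, abs_mul, abs_mul, abs_of_pos (by positivity : 0 < 2 / (b - a)), hk,
    abs_of_nonneg (by positivity : 0 ≤ (n * (Real.pi / (b - a))) ^ j), mul_pow]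
  calc 2 / (b - a) * |c n| * ((n : ℝ) ^ j * (Real.pi / (b - a)) ^ j) * |Real.sin θ|
      ≤ 2 / (b - a) * (C / (n : ℝ) ^ 6) * ((n : ℝ) ^ 4 * (Real.pi / (b - a)) ^ j) * 1 := by
        gcongr
        exact hc n
    _ = _ := by field_simp

theorem summable_sineSeries_bound (K : ℝ) : Summable (fun n : ℕ => K * (1 / (n : ℝ) ^ 2)) :=
  (Real.summable_one_div_nat_pow.2 one_lt_two).mul_left K

theorem hasDerivAt_sineSeries {a b C : ℝ} (hab : a < b) {c : ℕ → ℝ}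
    (hc : ∀ n, |c n| ≤ C / (n : ℝ) ^ 6) {j : ℕ} (hj : j < 4) (x : ℝ) :
    HasDerivAt (sineSeries a b c j) (sineSeries a b c (j + 1) x) x := by
  unfold sineSeries
  refine hasDerivAt_tsum (y₀ := x)
    (g' := fun n y => 2 / (b - a) * c n * sineFreq a b n ^ (j + 1)
      * Real.sin (sineFreq a b n * (y - a) + ((j + 1 : ℕ) : ℝ) * (Real.pi / 2)))
    (summable_sineSeries_bound _) ?_
    (fun n y => abs_sineSeries_term_le hab hc hj _ n) ?_ x
  · intro n y
    have hlin : HasDerivAt (fun y => sineFreq a b n * (y - a) + j * (Real.pi / 2))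
        (sineFreq a b n) y := by
      simpa using (((hasDerivAt_id y).sub_const a).const_mul (sineFreq a b n)).add_const
        (j * (Real.pi / 2))
    refine (hlin.sin.const_mul _).congr_deriv ?_
    rw [show sineFreq a b n * (y - a) + ((j + 1 : ℕ) : ℝ) * (Real.pi / 2)
      = sineFreq a b n * (y - a) + j * (Real.pi / 2) + Real.pi / 2 by push_cast; ring,
      Real.sin_add_pi_div_two]
    ring
  · exact Summable.of_norm_bounded (summable_sineSeries_bound _)
      fun n => abs_sineSeries_term_le hab hc hj.le _ n

theorem continuousOn_sineSeries {a b C : ℝ} (hab : a < b) {c : ℕ → ℝ → ℝ} {S : Set ℝ}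
    (hc : ∀ s ∈ S, ∀ n, |c n s| ≤ C / (n : ℝ) ^ 6) (hcc : ∀ n, ContinuousOn (c n) S)
    {j : ℕ} (hj : j ≤ 4) :
    ContinuousOn (uncurry fun x s => sineSeries a b (fun n => c n s) j x) (univ ×ˢ S) := by
  unfold sineSeries
  refine continuousOn_tsum (fun n => ?_) (summable_sineSeries_bound _)
    (fun n p hp => abs_sineSeries_term_le hab (hc p.2 hp.2) hj _ n)
  have : ContinuousOn (fun p : ℝ × ℝ => c n p.2) (univ ×ˢ S) :=
    (hcc n).comp continuousOn_snd fun p hp => hp.2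
  exact ((this.const_mul _).mul_const _).mul (by fun_prop)

theorem sineSeries_two_left (a b : ℝ) (c : ℕ → ℝ) : sineSeries a b c 2 a = 0 := by
  simp [sineSeries, mul_div_cancel₀]

theorem sineSeries_two_right {a b : ℝ} (hab : a < b) (c : ℕ → ℝ) : sineSeries a b c 2 b = 0 := by
  simp [sineSeries, sineFreq_mul_sub hab, mul_div_cancel₀, Real.sin_add_pi, Real.sin_nat_mul_pi]

theorem sineSeries_zero_eq {a b C : ℝ} (hab : a < b) {p : ℝ → ℝ} (hp : ContinuousOn p (Icc a b))
    (hpa : p a = 0) (hpb : p b = 0) (hc : ∀ n, |sineCoeff a b p n| ≤ C / (n : ℝ) ^ 6)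
    {x : ℝ} (hx : x ∈ Icc a b) : sineSeries a b (sineCoeff a b p) 0 x = p x := by
  have hs : Summable (sineCoeff a b p) := by
    refine Summable.of_norm_bounded ((Real.summable_one_div_nat_pow.2
      (by norm_num : 1 < 6)).mul_left C) fun n => ?_
    simpa [div_eq_mul_inv] using hc n
  rw [← (hasSum_sineCoeff hab hp hpa hpb hs hx).tsum_eq]
  simp [sineSeries]

theorem exp_neg_le_six_div_pow {x y : ℝ} (hx : 0 < x) (hxy : x ≤ y) :
    Real.exp (-y) ≤ 6 / x ^ 3 := by
  have h := Real.pow_div_factorial_le_exp x hx.le 3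
  have h' : x ^ 3 / 6 ≤ Real.exp y := by
    refine le_trans ?_ (Real.exp_le_exp.2 hxy)
    simpa [Nat.factorial] using h
  rw [Real.exp_neg, ← inv_div]
  exact inv_anti₀ (by positivity) h'

/-- Classical solutions of `u_t = ε u_{xx} + v` with `u = 0` at the endpoints. -/
structure IsDirichletHeatSol (a b ε : ℝ) (u ut ux uxx v : ℝ → ℝ → ℝ) : Prop where
  hut : ∀ x ∈ Icc a b, ∀ s ∈ Ioi (0 : ℝ), HasDerivAt (u x) (ut x s) s
  hux : ∀ x ∈ Icc a b, ∀ s ∈ Ioi (0 : ℝ), HasDerivAt (fun y => u y s) (ux x s) x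
  huxx : ∀ x ∈ Icc a b, ∀ s ∈ Ioi (0 : ℝ), HasDerivAt (fun y => ux y s) (uxx x s) x
  hutc : ContinuousOn (uncurry ut) (Icc a b ×ˢ Ioi 0)
  huxxc : ContinuousOn (uncurry uxx) (Icc a b ×ˢ Ioi 0)
  hub : ∀ s ∈ Ioi (0 : ℝ), u a s = 0 ∧ u b s = 0
  hvc : ContinuousOn (uncurry v) (Icc a b ×ˢ Ioi 0)
  heq : ∀ x ∈ Ioo a b, ∀ s ∈ Ioi (0 : ℝ), ut x s = ε * uxx x s + v x s

/-- Functions of class `C⁴` in space with `v = v_{xx} = 0` at the endpoints. -/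
structure IsNavierC4 (a b : ℝ) (v v₁ v₂ v₃ v₄ : ℝ → ℝ → ℝ) : Prop where
  hv₁ : ∀ x ∈ Icc a b, ∀ s ∈ Ioi (0 : ℝ), HasDerivAt (fun y => v y s) (v₁ x s) x
  hv₂ : ∀ x ∈ Icc a b, ∀ s ∈ Ioi (0 : ℝ), HasDerivAt (fun y => v₁ y s) (v₂ x s) x
  hv₃ : ∀ x ∈ Icc a b, ∀ s ∈ Ioi (0 : ℝ), HasDerivAt (fun y => v₂ y s) (v₃ x s) x
  hv₄ : ∀ x ∈ Icc a b, ∀ s ∈ Ioi (0 : ℝ), HasDerivAt (fun y => v₃ y s) (v₄ x s) x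
  hv₄c : ContinuousOn (uncurry v₄) (Icc a b ×ˢ Ioi 0)
  hvb : ∀ s ∈ Ioi (0 : ℝ), v a s = 0 ∧ v b s = 0 ∧ v₂ a s = 0 ∧ v₂ b s = 0

/-- Time derivative of the sine coefficients of a solution of the heat equation. -/
theorem hasDerivAt_sineCoeff_heat {a b ε : ℝ} (hab : a < b) {u ut ux uxx v : ℝ → ℝ → ℝ}
    (hu : IsDirichletHeatSol a b ε u ut ux uxx v)
    (n : ℕ) {s : ℝ} (hs : 0 < s) :
    HasDerivAt (fun r => sineCoeff a b (fun x => u x r) n)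
      (-(ε * sineFreq a b n ^ 2) * sineCoeff a b (fun x => u x s) n
        + sineCoeff a b (fun x => v x s) n) s := by
  obtain ⟨hut, hux, huxx, hutc, huxxc, hub, hvc, heq⟩ := hu
  have hsub : Icc (s / 2) (2 * s) ⊆ Ioi 0 := fun r hr => lt_of_lt_of_le (by positivity) hr.1
  have hsl : ∀ w : ℝ → ℝ → ℝ, ContinuousOn (uncurry w) (Icc a b ×ˢ Ioi 0) →
      ∀ r ∈ Ioi (0 : ℝ), ContinuousOn (fun x => w x r) (Icc a b) := fun w hw r hr =>
    hw.comp (f := fun x => (x, r)) (by fun_prop) (fun x hx => ⟨hx, hr⟩)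
  have huc : ∀ r ∈ Ioi (0 : ℝ), ContinuousOn (fun x => u x r) (Icc a b) :=
    fun r hr x hx => (hux x hx r hr).continuousAt.continuousWithinAt
  let e : ℝ → ℝ := fun x => Real.sin (sineFreq a b n * (x - a))
  have hec : Continuous e := by fun_prop
  have key := hasDerivAt_of_sub_eq_integral hab.le (t := s) (t₁ := s / 2) (t₂ := 2 * s)
    ⟨by linarith, by linarith⟩ (w := u) (wt := ut) (g := fun x _ => e x / 2)
    (F := fun r => sineCoeff a b (fun x => u x r) n)
    (fun x hx r hr => hut x hx r (hsub hr)) (fun r hr => huc r (hsub hr))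
    (hutc.mono (prod_mono_right hsub))
    (by
      have : Continuous (uncurry fun x (_ : ℝ) => e x / 2) := by
        simp only [uncurry_def]; fun_prop
      exact this.continuousOn) ?_
  · refine key.congr_deriv ?_
    have h2 := sineCoeff_deriv2 hab (fun x hx => hux x hx s hs) (fun x hx => huxx x hx s hs)
      (hsl _ huxxc s hs) (hub s hs).1 (hub s hs).2 n
    rw [show -(ε * sineFreq a b n ^ 2) * sineCoeff a b (fun x => u x s) n
      = ε * (-sineFreq a b n ^ 2 * sineCoeff a b (fun x => u x s) n) by ring, ← h2]
    unfold sineCoeff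
    rw [← intervalIntegral.integral_const_mul, ← intervalIntegral.integral_const_mul,
      ← intervalIntegral.integral_add]
    · refine intervalIntegral.integral_congr_Ioo_of_le hab.le fun x hx => ?_
      simp only [heq x hx s hs, e]
      ring
    · exact (((hsl _ huxxc s hs).mul hec.continuousOn).const_mul ε).intervalIntegrable_of_Icc hab.le
    · exact ((hsl _ hvc s hs).mul hec.continuousOn).intervalIntegrable_of_Icc hab.le
  · intro r hr
    unfold sineCoeff
    rw [← intervalIntegral.integral_sub]
    · exact intervalIntegral.integral_congr fun x _ => by simp only [e]; ring
    · exact ((huc r (hsub hr)).mul hec.continuousOn).intervalIntegrable_of_Icc hab.le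
    · exact ((huc s hs).mul hec.continuousOn).intervalIntegrable_of_Icc hab.le

/-- Sixth-order decay of the sine coefficients of solutions of the Dirichlet heat equation whose
forcing is `C⁴` in space and satisfies `v = v_{xx} = 0` at the endpoints. -/
theorem exists_bound_sineCoeff_heat {a b ε : ℝ} (hab : a < b) (hε : 0 < ε)
    {u ut ux uxx v v₁ v₂ v₃ v₄ : ℝ → ℝ → ℝ}
    (hu : IsDirichletHeatSol a b ε u ut ux uxx v) (hv : IsNavierC4 a b v v₁ v₂ v₃ v₄)
    {t₁ t₂ : ℝ} (ht₁ : 0 < t₁) :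
    ∃ C, ∀ s ∈ Icc t₁ t₂, ∀ n, |sineCoeff a b (fun x => u x s) n| ≤ C / (n : ℝ) ^ 6 := by
  have hL : 0 < b - a := sub_pos.2 hab
  have hτ : 0 < t₁ / 2 := by positivity
  have hsub : Icc (t₁ / 2) t₂ ⊆ Ioi 0 := fun r hr => hτ.trans_le hr.1
  have huc : ContinuousOn (fun x => u x (t₁ / 2)) (Icc a b) :=
    fun x hx => (hu.hux x hx _ hτ).continuousAt.continuousWithinAt
  obtain ⟨N, hN⟩ := isCompact_Icc.exists_bound_of_continuousOn huc
  obtain ⟨M, hM⟩ := (isCompact_Icc.prod isCompact_Icc).exists_bound_of_continuousOn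
    (hv.hv₄c.mono (prod_mono_right hsub))
  have hN0 : 0 ≤ N := (norm_nonneg _).trans (hN a ⟨le_rfl, hab.le⟩)
  set κ := Real.pi / (b - a) with hκ
  have hκ0 : 0 < κ := div_pos Real.pi_pos hL
  refine ⟨6 / (ε * κ ^ 2 * (t₁ / 2)) ^ 3 * (N * (b - a)) + M * (b - a) / (ε * κ ^ 6), ?_⟩
  intro s hs n
  rcases Nat.eq_zero_or_pos n with rfl | hn
  · simp [sineCoeff, sineFreq]
  have hn0 : (0 : ℝ) < n := by exact_mod_cast hn
  have hk : sineFreq a b n = n * κ := by simp only [sineFreq, hκ]; ring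
  have hk0 : 0 < sineFreq a b n := hk ▸ by positivity
  have hsl : ∀ w : ℝ → ℝ → ℝ, ContinuousOn (uncurry w) (Icc a b ×ˢ Ioi 0) →
      ∀ r ∈ Ioi (0 : ℝ), ContinuousOn (fun x => w x r) (Icc a b) := fun w hw r hr =>
    hw.comp (f := fun x => (x, r)) (by fun_prop) (fun x hx => ⟨hx, hr⟩)
  have hvcoef : ∀ r ∈ Icc (t₁ / 2) s,
      |sineCoeff a b (fun x => v x r) n| ≤ M * (b - a) / sineFreq a b n ^ 4 := by
    intro r hr
    have hr2 : r ∈ Icc (t₁ / 2) t₂ := ⟨hr.1, hr.2.trans hs.2⟩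
    have hr0 := hsub hr2
    have h1 := sineCoeff_deriv2 hab (fun x hx => hv.hv₁ x hx r hr0) (fun x hx => hv.hv₂ x hx r hr0)
      (fun x hx => (hv.hv₃ x hx r hr0).continuousAt.continuousWithinAt)
      (hv.hvb r hr0).1 (hv.hvb r hr0).2.1 n
    have h2 := sineCoeff_deriv2 hab (fun x hx => hv.hv₃ x hx r hr0) (fun x hx => hv.hv₄ x hx r hr0)
      (hsl _ hv.hv₄c r hr0) (hv.hvb r hr0).2.2.1 (hv.hvb r hr0).2.2.2 n
    have h3 := abs_sineCoeff_le hab.le (p := fun x => v₄ x r) (fun x hx => hM (x, r) ⟨hx, hr2⟩) n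
    rw [h2, h1, ← mul_assoc, abs_mul, abs_of_nonneg (by nlinarith [sq_nonneg (sineFreq a b n ^ 2)]),
      ← mul_comm] at h3
    rw [le_div_iff₀ (by positivity)]
    calc _ = _ := by ring
      _ ≤ _ := h3
  have hbound := abs_le_of_hasDerivAt_linear (μ := ε * sineFreq a b n ^ 2) (by positivity)
    (by linarith [hs.1] : t₁ / 2 ≤ s)
    (fun r hr => hasDerivAt_sineCoeff_heat hab hu n
      (hτ.trans_le hr.1)) hvcoef
  have hexp : Real.exp (-(ε * sineFreq a b n ^ 2 * (s - t₁ / 2)))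
      ≤ 6 / (ε * sineFreq a b n ^ 2 * (t₁ / 2)) ^ 3 := by
    refine exp_neg_le_six_div_pow (by positivity) ?_
    have : t₁ / 2 ≤ s - t₁ / 2 := by linarith [hs.1]
    gcongr
  have hNL := abs_sineCoeff_le hab.le hN n
  calc _ ≤ _ := hbound
    _ ≤ 6 / (ε * sineFreq a b n ^ 2 * (t₁ / 2)) ^ 3 * (N * (b - a))
        + M * (b - a) / sineFreq a b n ^ 4 / (ε * sineFreq a b n ^ 2) := by
      gcongr
    _ = _ := by
      rw [hk]
      field_simp

/-- Spatial `C⁴` regularity up to the boundary for the forced Dirichlet heat equation. -/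
theorem exists_C4_representation_heat {a b ε : ℝ} (hab : a < b) (hε : 0 < ε)
    {u ut ux uxx v v₁ v₂ v₃ v₄ : ℝ → ℝ → ℝ}
    (hu : IsDirichletHeatSol a b ε u ut ux uxx v) (hv : IsNavierC4 a b v v₁ v₂ v₃ v₄)
    {t₁ t₂ : ℝ} (ht₁ : 0 < t₁) :
    ∃ U : ℕ → ℝ → ℝ → ℝ,
      (∀ x ∈ Icc a b, ∀ s ∈ Icc t₁ t₂, U 0 x s = u x s) ∧
      (∀ j < 4, ∀ x, ∀ s ∈ Icc t₁ t₂, HasDerivAt (fun y => U j y s) (U (j + 1) x s) x) ∧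
      (∀ j ≤ 4, ContinuousOn (uncurry (U j)) (univ ×ˢ Icc t₁ t₂)) ∧
      ∀ s, U 2 a s = 0 ∧ U 2 b s = 0 := by
  obtain ⟨C, hC⟩ := exists_bound_sineCoeff_heat hab hε hu hv (t₂ := t₂) ht₁
  refine ⟨fun j x s => sineSeries a b (sineCoeff a b fun y => u y s) j x, ?_, ?_, ?_, ?_⟩
  · intro x hx s hs
    have hs0 : s ∈ Ioi (0 : ℝ) := ht₁.trans_le hs.1
    exact sineSeries_zero_eq hab
      (fun y hy => (hu.hux y hy s hs0).continuousAt.continuousWithinAt) (hu.hub s hs0).1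
      (hu.hub s hs0).2
      (hC s hs) hx
  · exact fun j hj x s hs => hasDerivAt_sineSeries hab (hC s hs) hj x
  · intro j hj
    exact continuousOn_sineSeries (c := fun n s => sineCoeff a b (fun y => u y s) n) hab hC
      (fun n s hs => (hasDerivAt_sineCoeff_heat hab hu n
        (ht₁.trans_le hs.1)).continuousAt.continuousWithinAt) hj
  · exact fun s => ⟨sineSeries_two_left a b _, sineSeries_two_right hab _⟩

theorem continuousOn_slice {a b : ℝ} {S : Set ℝ} {w : ℝ → ℝ → ℝ}
    (hw : ContinuousOn (uncurry w) (Icc a b ×ˢ S)) {s : ℝ} (hs : s ∈ S) :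
    ContinuousOn (fun x => w x s) (Icc a b) :=
  hw.comp (f := fun x => (x, s)) (by fun_prop) (fun _ hx => ⟨hx, hs⟩)

/-- Energy identity for `u_{xx}`, including existence of `u_{xxx}` in the interior. -/
theorem hasDerivAt_integral_deriv2_sq_heat {a b ε : ℝ} (hab : a < b) (hε : 0 < ε)
    {u ut ux uxx v v₁ v₂ v₃ v₄ : ℝ → ℝ → ℝ}
    (hu : IsDirichletHeatSol a b ε u ut ux uxx v) (hv : IsNavierC4 a b v v₁ v₂ v₃ v₄)
    {t : ℝ} (ht : 0 < t) :
    HasDerivAt (fun s => ∫ x in a..b, (uxx x s) ^ 2)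
      (-(2 * ε) * (∫ x in a..b, (deriv (fun y => uxx y t) x) ^ 2)
        + 2 * ∫ x in a..b, uxx x t * v₂ x t) t := by
  obtain ⟨U, hU0, hUd, hUc, hUb⟩ := exists_C4_representation_heat hab hε hu hv
    (t₁ := t / 2) (t₂ := 2 * t) (by positivity)
  have htI : t ∈ Ioo (t / 2) (2 * t) := ⟨by linarith, by linarith⟩
  have htc : t ∈ Icc (t / 2) (2 * t) := Ioo_subset_Icc_self htI
  have hsub : Icc (t / 2) (2 * t) ⊆ Ioi 0 := fun r hr => lt_of_lt_of_le (by positivity) hr.1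
  have hUs : ∀ j ≤ 4, ∀ s ∈ Icc (t / 2) (2 * t), ContinuousOn (fun x => U j x s) (Icc a b) :=
    fun j hj s hs => continuousOn_slice ((hUc j hj).mono (prod_mono_left (subset_univ _))) hs
  have e1 : ∀ s ∈ Icc (t / 2) (2 * t), ∀ x ∈ Ioo a b, ux x s = U 1 x s := by
    intro s hs x hx
    refine (hu.hux x (Ioo_subset_Icc_self hx) s (hsub hs)).unique
      ((hUd 0 (by norm_num) x s hs).congr_of_eventuallyEq ?_)
    filter_upwards [Ioo_mem_nhds hx.1 hx.2] with y hy
    exact (hU0 y (Ioo_subset_Icc_self hy) s hs).symm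
  have e2 : ∀ s ∈ Icc (t / 2) (2 * t), ∀ x ∈ Ioo a b, uxx x s = U 2 x s := by
    intro s hs x hx
    refine (hu.huxx x (Ioo_subset_Icc_self hx) s (hsub hs)).unique
      ((hUd 1 (by norm_num) x s hs).congr_of_eventuallyEq ?_)
    filter_upwards [Ioo_mem_nhds hx.1 hx.2] with y hy
    exact e1 s hs y hy
  have e3 : ∀ x ∈ Ioo a b, deriv (fun y => uxx y t) x = U 3 x t := by
    intro x hx
    refine ((hUd 2 (by norm_num) x t htc).congr_of_eventuallyEq ?_).deriv
    filter_upwards [Ioo_mem_nhds hx.1 hx.2] with y hy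
    exact e2 t htc y hy
  have hU0b : ∀ s ∈ Icc (t / 2) (2 * t), U 0 a s = 0 ∧ U 0 b s = 0 := fun s hs =>
    ⟨(hU0 a ⟨le_rfl, hab.le⟩ s hs).trans (hu.hub s (hsub hs)).1,
      (hU0 b ⟨hab.le, le_rfl⟩ s hs).trans (hu.hub s (hsub hs)).2⟩
  have key := hasDerivAt_of_sub_eq_integral hab.le htI (w := u) (wt := ut) (g := U 4)
    (F := fun s => ∫ x in a..b, (uxx x s) ^ 2)
    (fun x hx s hs => hu.hut x hx s (hsub hs))
    (fun s hs x hx => (hu.hux x hx s (hsub hs)).continuousAt.continuousWithinAt)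
    (hu.hutc.mono (prod_mono_right hsub)) ((hUc 4 le_rfl).mono (prod_mono_left (subset_univ _))) ?_
  · refine key.congr_deriv ?_
    have h1 : ∫ x in a..b, ut x t * U 4 x t
        = ε * (∫ x in a..b, U 4 x t * U 2 x t) + ∫ x in a..b, v x t * U 4 x t := by
      rw [← intervalIntegral.integral_const_mul, ← intervalIntegral.integral_add]
      · refine intervalIntegral.integral_congr_Ioo_of_le hab.le fun x hx => ?_
        simp only [hu.heq x hx t ht, e2 t htc x hx]
        ring
      · exact (((hUs 4 le_rfl t htc).mul (hUs 2 (by norm_num) t htc)).const_mul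
          ε).intervalIntegrable_of_Icc hab.le
      · exact ((continuousOn_slice hu.hvc ht).mul
          (hUs 4 le_rfl t htc)).intervalIntegrable_of_Icc hab.le
    have h2 : ∫ x in a..b, U 4 x t * U 2 x t = -∫ x in a..b, U 3 x t * U 3 x t :=
      integral_deriv_mul_eq_neg hab.le (fun x _ => hUd 3 (by norm_num) x t htc)
        (fun x _ => hUd 2 (by norm_num) x t htc) (hUs 4 le_rfl t htc) (hUs 3 (by norm_num) t htc)
        (by simp [hUb]) (by simp [hUb])
    have h3 : ∫ x in a..b, v₂ x t * U 2 x t = ∫ x in a..b, v x t * U 4 x t :=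
      integral_deriv2_mul_eq hab.le (fun x hx => hv.hv₁ x hx t ht) (fun x hx => hv.hv₂ x hx t ht)
        (fun x hx => (hv.hv₃ x hx t ht).continuousAt.continuousWithinAt)
        (fun x _ => hUd 2 (by norm_num) x t htc) (fun x _ => hUd 3 (by norm_num) x t htc)
        (hUs 4 le_rfl t htc) (hv.hvb t ht).1 (hv.hvb t ht).2.1 (hUb t).1 (hUb t).2
    have h4 : ∫ x in a..b, (deriv (fun y => uxx y t) x) ^ 2 = ∫ x in a..b, U 3 x t * U 3 x t :=
      intervalIntegral.integral_congr_Ioo_of_le hab.le fun x hx => by simp only [e3 x hx]; ring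
    have h5 : ∫ x in a..b, uxx x t * v₂ x t = ∫ x in a..b, v₂ x t * U 2 x t :=
      intervalIntegral.integral_congr_Ioo_of_le hab.le fun x hx => by
        simp only [e2 t htc x hx]; ring
    rw [h1, h2, h4, h5, h3]
    ring
  · intro s hs
    have hsq : ∀ r ∈ Icc (t / 2) (2 * t),
        ∫ x in a..b, (uxx x r) ^ 2 = ∫ x in a..b, (U 2 x r) ^ 2 := fun r hr =>
      intervalIntegral.integral_congr_Ioo_of_le hab.le fun x hx => by simp only [e2 r hr x hx]
    have hI : ∀ r ∈ Icc (t / 2) (2 * t), IntervalIntegrable (fun x => (U 2 x r) ^ 2) volume a b :=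
      fun r hr => ((hUs 2 (by norm_num) r hr).pow 2).intervalIntegrable_of_Icc hab.le
    have h := integral_deriv2_mul_eq hab.le (p := fun x => U 0 x s - U 0 x t)
      (q := fun x => U 2 x s + U 2 x t)
      (fun x _ => (hUd 0 (by norm_num) x s hs).sub (hUd 0 (by norm_num) x t htc))
      (fun x _ => (hUd 1 (by norm_num) x s hs).sub (hUd 1 (by norm_num) x t htc))
      ((hUs 2 (by norm_num) s hs).sub (hUs 2 (by norm_num) t htc))
      (fun x _ => (hUd 2 (by norm_num) x s hs).add (hUd 2 (by norm_num) x t htc))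
      (fun x _ => (hUd 3 (by norm_num) x s hs).add (hUd 3 (by norm_num) x t htc))
      ((hUs 4 le_rfl s hs).add (hUs 4 le_rfl t htc))
      (by simp [hU0b s hs, hU0b t htc]) (by simp [hU0b s hs, hU0b t htc])
      (by simp [hUb]) (by simp [hUb])
    simp only [hsq s hs, hsq t htc]
    rw [← intervalIntegral.integral_sub (hI s hs) (hI t htc)]
    calc _ = ∫ x in a..b, (U 2 x s - U 2 x t) * (U 2 x s + U 2 x t) :=
          intervalIntegral.integral_congr fun x _ => by ring
      _ = _ := h
      _ = _ := intervalIntegral.integral_congr_Ioo_of_le hab.le fun x hx => by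
        simp only [hU0 x (Ioo_subset_Icc_self hx) s hs, hU0 x (Ioo_subset_Icc_self hx) t htc]

/-- Time derivative of the weighted Dirichlet energy `∫ ρ(Θ) Θ_x²` under Neumann conditions,
obtained from the substitution `Φ(Θ)` with `Φ' = √ρ`. -/
theorem hasDerivAt_integral_weighted_deriv_sq {a b t t₁ t₂ : ℝ} (hab : a ≤ b) (ht : t ∈ Ioo t₁ t₂)
    {ρ ρ' : ℝ → ℝ} (hρ : ∀ z ∈ Ioi (0 : ℝ), HasDerivAt ρ (ρ' z) z)
    (hρ' : ContinuousOn ρ' (Ioi 0)) (hρ0 : ∀ z ∈ Ioi (0 : ℝ), 0 < ρ z)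
    {Θ Θt Θx Θxx : ℝ → ℝ → ℝ}
    (hΘt : ∀ x ∈ Icc a b, ∀ s ∈ Icc t₁ t₂, HasDerivAt (Θ x) (Θt x s) s)
    (hΘx : ∀ x ∈ Icc a b, ∀ s ∈ Icc t₁ t₂, HasDerivAt (fun y => Θ y s) (Θx x s) x)
    (hΘxx : ∀ x ∈ Icc a b, ∀ s ∈ Icc t₁ t₂, HasDerivAt (fun y => Θx y s) (Θxx x s) x)
    (hΘc : ContinuousOn (uncurry Θ) (Icc a b ×ˢ Icc t₁ t₂))
    (hΘtc : ContinuousOn (uncurry Θt) (Icc a b ×ˢ Icc t₁ t₂))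
    (hΘxc : ContinuousOn (uncurry Θx) (Icc a b ×ˢ Icc t₁ t₂))
    (hΘxxc : ContinuousOn (uncurry Θxx) (Icc a b ×ˢ Icc t₁ t₂))
    (hΘ0 : ∀ x ∈ Icc a b, ∀ s ∈ Icc t₁ t₂, 0 < Θ x s)
    (hbd : ∀ s ∈ Icc t₁ t₂, Θx a s = 0 ∧ Θx b s = 0) :
    HasDerivAt (fun s => ∫ x in a..b, ρ (Θ x s) * (Θx x s) ^ 2)
      (-2 * ∫ x in a..b, Θt x t * (ρ (Θ x t) * Θxx x t + 1 / 2 * ρ' (Θ x t) * (Θx x t) ^ 2)) t := by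
  have htI : t ∈ Icc t₁ t₂ := Ioo_subset_Icc_self ht
  let r : ℝ → ℝ := fun z => Real.sqrt (ρ z)
  let r' : ℝ → ℝ := fun z => ρ' z / (2 * r z)
  let Φ : ℝ → ℝ := fun z => ∫ y in (1 : ℝ)..z, r y
  have hr0 : ∀ z ∈ Ioi (0 : ℝ), 0 < r z := fun z hz => Real.sqrt_pos.2 (hρ0 z hz)
  have hrsq : ∀ z ∈ Ioi (0 : ℝ), r z ^ 2 = ρ z := fun z hz => Real.sq_sqrt (hρ0 z hz).le
  have hr : ∀ z ∈ Ioi (0 : ℝ), HasDerivAt r (r' z) z := fun z hz =>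
    (hρ z hz).sqrt (hρ0 z hz).ne'
  have hrc : ContinuousOn r (Ioi 0) := fun z hz => (hr z hz).continuousAt.continuousWithinAt
  have hr'c : ContinuousOn r' (Ioi 0) :=
    hρ'.div (continuousOn_const.mul hrc) fun z hz => (mul_pos two_pos (hr0 z hz)).ne'
  have hΦ : ∀ z ∈ Ioi (0 : ℝ), HasDerivAt Φ (r z) z := by
    intro z hz
    refine intervalIntegral.integral_hasDerivAt_right ?_
      (hrc.stronglyMeasurableAtFilter isOpen_Ioi z hz) (hr z hz).continuousAt
    refine (hrc.mono fun y hy => ?_).intervalIntegrable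
    exact (lt_min one_pos hz).trans_le hy.1
  have hmaps : MapsTo (uncurry Θ) (Icc a b ×ˢ Icc t₁ t₂) (Ioi 0) :=
    fun p hp => hΘ0 p.1 hp.1 p.2 hp.2
  have hrΘ : ContinuousOn (uncurry fun x s => r (Θ x s)) (Icc a b ×ˢ Icc t₁ t₂) :=
    hrc.comp hΘc hmaps
  have hr'Θ : ContinuousOn (uncurry fun x s => r' (Θ x s)) (Icc a b ×ˢ Icc t₁ t₂) :=
    hr'c.comp hΘc hmaps
  have key := hasDerivAt_integral_deriv_sq hab ht (w := fun x s => Φ (Θ x s))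
    (wt := fun x s => r (Θ x s) * Θt x s) (wx := fun x s => r (Θ x s) * Θx x s)
    (wxx := fun x s => r' (Θ x s) * Θx x s * Θx x s + r (Θ x s) * Θxx x s)
    (fun x hx s hs => (hΦ _ (hΘ0 x hx s hs)).comp s (hΘt x hx s hs))
    (fun x hx s hs => HasDerivAt.comp (h₂ := Φ) (h := fun y => Θ y s) x (hΦ _ (hΘ0 x hx s hs))
      (hΘx x hx s hs))
    (fun x hx s hs => (HasDerivAt.comp (h₂ := r) (h := fun y => Θ y s) x (hr _ (hΘ0 x hx s hs))
      (hΘx x hx s hs)).mul (hΘxx x hx s hs))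
    (hrΘ.mul hΘtc) (((hr'Θ.mul hΘxc).mul hΘxc).add (hrΘ.mul hΘxxc))
    (fun s hs => by simp [hbd s hs, hbd t htI])
  refine (key.congr_of_eventuallyEq ?_).congr_deriv ?_
  · filter_upwards [Icc_mem_nhds ht.1 ht.2] with s hs
    refine intervalIntegral.integral_congr fun x hx => ?_
    rw [uIcc_of_le hab] at hx
    simp only [mul_pow, hrsq _ (hΘ0 x hx s hs)]
  · congr 1
    refine intervalIntegral.integral_congr fun x hx => ?_
    rw [uIcc_of_le hab] at hx
    have h0 := hr0 _ (hΘ0 x hx t htI)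
    simp only [r', ← hrsq _ (hΘ0 x hx t htI)]
    field_simp
    ring

/-- A nonlinearity satisfying (F) is positive on `(0,∞)`. -/
theorem HypF.apply_pos {f f' f'' : ℝ → ℝ} (hf : HypF f f' f'') : ∀ z ∈ Ioi (0 : ℝ), 0 < f z := by
  have hmono : StrictMonoOn f (Ici 0) := by
    refine strictMonoOn_of_deriv_pos (convex_Ici 0)
      (fun z hz => (hf.hasDeriv₁ z hz).continuousWithinAt) fun z hz => ?_
    have hz0 : 0 < z := by simpa using hz
    rw [((hf.hasDeriv₁ z hz0.le).hasDerivAt (Ici_mem_nhds hz0)).deriv]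
    exact hf.pos z hz0.le
  intro z hz
  have h := hmono self_mem_Ici (Ioi_subset_Ici_self hz) hz
  rwa [hf.zero] at h

/-- Lemma 4.3: the differential identity for the higher-order energy of
solutions of (P_ε), with `ρ(ξ) = f'(ξ)/f(ξ)` and
`ρ'(ξ) = (f''(ξ)f(ξ) - f'(ξ)²)/f(ξ)²`. -/
theorem statement12
    (a b : ℝ) (hab : a < b)
    (f f' f'' : ℝ → ℝ) (hf : HypF f f' f'')
    (v0 u0 Θ0 : ℝ → ℝ) (hdata : SmoothData a b v0 u0 Θ0)
    (ε : ℝ) (hε : ε ∈ Ioo (0 : ℝ) 1)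
    (v u Θ : ℝ → ℝ → ℝ)
    (hsol : IsClassicalSolEps a b f ε v0 u0 Θ0 v u Θ) :
    ∀ t ∈ Ioi (0 : ℝ),
      HasDerivAt (fun s =>
          (1 / 2) * (∫ x in Ioo a b, (pdx v x s) ^ 2)
          + (1 / 2) * (∫ x in Ioo a b, (pdx^[2] u x s) ^ 2)
          + (1 / 2) * ∫ x in Ioo a b, (f' (Θ x s) / f (Θ x s)) * (pdx Θ x s) ^ 2)
        (-(∫ x in Ioo a b, (f' (Θ x t) / f (Θ x t)) * (pdx^[2] Θ x t) ^ 2)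
          - ε * (∫ x in Ioo a b, (pdx^[3] v x t) ^ 2)
          - ε * (∫ x in Ioo a b, (pdx^[3] u x t) ^ 2)
          - (1 / 2) * (∫ x in Ioo a b,
              ((f'' (Θ x t) * f (Θ x t) - (f' (Θ x t)) ^ 2) / (f (Θ x t)) ^ 2)
                * (pdx Θ x t) ^ 2 * pdx^[2] Θ x t)
          - (∫ x in Ioo a b,
              (f' (Θ x t) / f (Θ x t)) * f' (Θ x t) * (pdx Θ x t) ^ 2 * pdx v x t)
          - (1 / 2) * ∫ x in Ioo a b,
              ((f'' (Θ x t) * f (Θ x t) - (f' (Θ x t)) ^ 2) / (f (Θ x t)) ^ 2)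
                * f (Θ x t) * (pdx Θ x t) ^ 2 * pdx v x t) t := by
  intro t ht
  simp only [mem_Ioi] at ht
  set ρ : ℝ → ℝ := fun z => f' z / f z with hρdef
  set ρ' : ℝ → ℝ := fun z => (f'' z * f z - (f' z) ^ 2) / (f z) ^ 2 with hρ'def
  have hI : ∀ g : ℝ → ℝ, ∫ x in Ioo a b, g x = ∫ x in a..b, g x := fun g => by
    rw [intervalIntegral.integral_of_le hab.le, integral_Ioc_eq_integral_Ioo]
  simp only [hI]
  have hpos : Ioi (0 : ℝ) ⊆ Ici 0 := Ioi_subset_Ici_self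
  have htI : t ∈ Ioo (t / 2) (2 * t) := ⟨by linarith, by linarith⟩
  have hsub : Icc (t / 2) (2 * t) ⊆ Ioi 0 := fun r hr => lt_of_lt_of_le (by positivity) hr.1
  have hf1 : ∀ z ∈ Ioi (0 : ℝ), HasDerivAt f (f' z) z := fun z hz =>
    (hf.hasDeriv₁ z (hpos hz)).hasDerivAt (Ici_mem_nhds hz)
  have hf2 : ∀ z ∈ Ioi (0 : ℝ), HasDerivAt f' (f'' z) z := fun z hz =>
    (hf.hasDeriv₂ z (hpos hz)).hasDerivAt (Ici_mem_nhds hz)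
  have hf0 : ∀ z ∈ Ioi (0 : ℝ), 0 < f z := hf.apply_pos
  have hfc : ContinuousOn f (Ioi 0) := fun z hz => (hf1 z hz).continuousAt.continuousWithinAt
  have hf'c : ContinuousOn f' (Ioi 0) := fun z hz => (hf2 z hz).continuousAt.continuousWithinAt
  have hf''c : ContinuousOn f'' (Ioi 0) := hf.cont₂.mono hpos
  have hρ : ∀ z ∈ Ioi (0 : ℝ), HasDerivAt ρ (ρ' z) z := fun z hz =>
    ((hf2 z hz).div (hf1 z hz) (hf0 z hz).ne').congr_deriv (by simp only [hρ'def]; ring)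
  have hρc : ContinuousOn ρ (Ioi 0) := hf'c.div hfc fun z hz => (hf0 z hz).ne'
  have hρ'c : ContinuousOn ρ' (Ioi 0) :=
    ((hf''c.mul hfc).sub (hf'c.pow 2)).div (hfc.pow 2) fun z hz => (pow_pos (hf0 z hz) 2).ne'
  have hvd : ∀ k < 4, ∀ x ∈ Icc a b, ∀ s ∈ Ioi (0 : ℝ),
      HasDerivAt (fun y => pdx^[k] v y s) (pdx^[k + 1] v x s) x := fun k hk x hx s hs => by
    rw [iterate_succ_apply']
    exact (hsol.diffx_v k hk x hx s (hpos hs)).hasDerivAt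
  have hud : ∀ k < 2, ∀ x ∈ Icc a b, ∀ s ∈ Ioi (0 : ℝ),
      HasDerivAt (fun y => pdx^[k] u y s) (pdx^[k + 1] u x s) x := fun k hk x hx s hs => by
    rw [iterate_succ_apply']
    exact (hsol.diffx_u k hk x hx s (hpos hs)).hasDerivAt
  have hΘd : ∀ k < 2, ∀ x ∈ Icc a b, ∀ s ∈ Ioi (0 : ℝ),
      HasDerivAt (fun y => pdx^[k] Θ y s) (pdx^[k + 1] Θ x s) x := fun k hk x hx s hs => by
    rw [iterate_succ_apply']
    exact (hsol.diffx_Θ k hk x hx s (hpos hs)).hasDerivAt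
  have hsubp : Icc a b ×ˢ Icc (t / 2) (2 * t) ⊆ Icc a b ×ˢ Ici 0 :=
    prod_mono_right (hsub.trans hpos)
  have hpp : Icc a b ×ˢ Ioi (0 : ℝ) ⊆ Icc a b ×ˢ Ici 0 := prod_mono_right hpos
  have hu : IsDirichletHeatSol a b ε u (pdt u) (pdx u) (pdx^[2] u) v :=
    { hut := fun x hx s hs => (hsol.difft_u x hx s (hpos hs)).hasDerivAt
      hux := hud 0 (by norm_num)
      huxx := hud 1 (by norm_num)
      hutc := hsol.contt_u.mono hpp
      huxxc := (hsol.cont_u 2 le_rfl).mono hpp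
      hub := hsol.bc_u
      hvc := (hsol.cont_v 0 (by norm_num)).mono hpp
      heq := hsol.eq_u }
  have hv : IsNavierC4 a b v (pdx v) (pdx^[2] v) (pdx^[3] v) (pdx^[4] v) :=
    { hv₁ := hvd 0 (by norm_num)
      hv₂ := hvd 1 (by norm_num)
      hv₃ := hvd 2 (by norm_num)
      hv₄ := hvd 3 (by norm_num)
      hv₄c := (hsol.cont_v 4 le_rfl).mono hpp
      hvb := hsol.bc_v }
  have hEv := hasDerivAt_integral_deriv_sq hab.le htI (w := v) (wt := pdt v) (wx := pdx v)
    (wxx := pdx^[2] v) (fun x hx s hs => (hsol.difft_v x hx s (hpos (hsub hs))).hasDerivAt)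
    (fun x hx s hs => hv.hv₁ x hx s (hsub hs)) (fun x hx s hs => hv.hv₂ x hx s (hsub hs))
    (hsol.contt_v.mono hsubp) ((hsol.cont_v 2 (by norm_num)).mono hsubp)
    (fun s hs => by simp [hv.hvb s (hsub hs), hv.hvb t ht])
  have hEu := hasDerivAt_integral_deriv2_sq_heat hab hε.1 hu hv ht
  have hEΘ := hasDerivAt_integral_weighted_deriv_sq hab.le htI hρ hρ'c
    (fun z hz => div_pos (hf.pos z (hpos hz)) (hf0 z hz)) (Θ := Θ) (Θt := pdt Θ) (Θx := pdx Θ)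
    (Θxx := pdx^[2] Θ) (fun x hx s hs => (hsol.difft_Θ x hx s (hpos (hsub hs))).hasDerivAt)
    (fun x hx s hs => hΘd 0 (by norm_num) x hx s (hsub hs))
    (fun x hx s hs => hΘd 1 (by norm_num) x hx s (hsub hs))
    ((hsol.cont_Θ 0 (by norm_num)).mono hsubp) (hsol.contt_Θ.mono hsubp)
    ((hsol.cont_Θ 1 (by norm_num)).mono hsubp) ((hsol.cont_Θ 2 le_rfl).mono hsubp)
    (fun x hx s hs => hsol.Θ_pos x hx s (hpos (hsub hs))) (fun s hs => hsol.bc_Θ s (hsub hs))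
  have hΘpos : MapsTo (fun x => Θ x t) (Icc a b) (Ioi 0) :=
    fun x hx => hsol.Θ_pos x hx t (hpos ht)
  have hcΘ : ContinuousOn (fun x => Θ x t) (Icc a b) :=
    continuousOn_slice (hsol.cont_Θ 0 (by norm_num)) (hpos ht)
  have hcΘ₁ : ContinuousOn (fun x => pdx Θ x t) (Icc a b) :=
    continuousOn_slice (hsol.cont_Θ 1 (by norm_num)) (hpos ht)
  have hcΘ₂ : ContinuousOn (fun x => pdx^[2] Θ x t) (Icc a b) :=
    continuousOn_slice (hsol.cont_Θ 2 le_rfl) (hpos ht)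
  have hcv₁ : ContinuousOn (fun x => pdx v x t) (Icc a b) :=
    continuousOn_slice (hsol.cont_v 1 (by norm_num)) (hpos ht)
  have hcv₂ : ContinuousOn (fun x => pdx^[2] v x t) (Icc a b) :=
    continuousOn_slice (hsol.cont_v 2 (by norm_num)) (hpos ht)
  have hcv₃ : ContinuousOn (fun x => pdx^[3] v x t) (Icc a b) :=
    continuousOn_slice (hsol.cont_v 3 (by norm_num)) (hpos ht)
  have hcv₄ : ContinuousOn (fun x => pdx^[4] v x t) (Icc a b) :=
    continuousOn_slice (hsol.cont_v 4 le_rfl) (hpos ht)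
  have hcu₂ : ContinuousOn (fun x => pdx^[2] u x t) (Icc a b) :=
    continuousOn_slice (hsol.cont_u 2 le_rfl) (hpos ht)
  have hcf : ContinuousOn (fun x => f (Θ x t)) (Icc a b) := hfc.comp hcΘ hΘpos
  have hcf' : ContinuousOn (fun x => f' (Θ x t)) (Icc a b) := hf'c.comp hcΘ hΘpos
  have hcf'' : ContinuousOn (fun x => f'' (Θ x t)) (Icc a b) := hf''c.comp hcΘ hΘpos
  have hcρ : ContinuousOn (fun x => ρ (Θ x t)) (Icc a b) := hρc.comp hcΘ hΘpos
  have hcρ' : ContinuousOn (fun x => ρ' (Θ x t)) (Icc a b) := hρ'c.comp hcΘ hΘpos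
  have hii : ∀ {g : ℝ → ℝ}, ContinuousOn g (Icc a b) → IntervalIntegrable g volume a b :=
    fun hg => hg.intervalIntegrable_of_Icc hab.le
  have hv_expand : ∫ x in a..b, pdt v x t * pdx^[2] v x t
      = -ε * (∫ x in a..b, pdx^[4] v x t * pdx^[2] v x t)
        + (∫ x in a..b, pdx^[2] u x t * pdx^[2] v x t)
        - ∫ x in a..b, f' (Θ x t) * pdx Θ x t * pdx^[2] v x t := by
    have h1 := (hcv₄.mul hcv₂).const_mul (-ε)
    have h2 := hcu₂.mul hcv₂
    have h3 := (hcf'.mul hcΘ₁).mul hcv₂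
    rw [← intervalIntegral.integral_const_mul, ← intervalIntegral.integral_add,
      ← intervalIntegral.integral_sub]
    rotate_left
    · exact hii (h1.add h2)
    · exact hii h3
    · exact hii h1
    · exact hii h2
    refine intervalIntegral.integral_congr_Ioo_of_le hab.le fun x hx => ?_
    have hx' := Ioo_subset_Icc_self hx
    have hchain : pdx (fun y s => f (Θ y s)) x t = f' (Θ x t) * pdx Θ x t :=
      (HasDerivAt.comp (h₂ := f) (h := fun y => Θ y t) x (hf1 _ (hΘpos hx'))
        (hΘd 0 (by norm_num) x hx' t ht)).deriv
    simp only [hsol.eq_v x hx t ht, hchain]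
    ring
  have hv_parts : ∫ x in a..b, pdx^[4] v x t * pdx^[2] v x t
      = -∫ x in a..b, (pdx^[3] v x t) ^ 2 := by
    simp only [pow_two]
    exact integral_deriv_mul_eq_neg hab.le (fun x hx => hv.hv₄ x hx t ht)
      (fun x hx => hv.hv₃ x hx t ht) hcv₄ hcv₃ (by simp [hv.hvb t ht]) (by simp [hv.hvb t ht])
  have hΘ_expand : ∫ x in a..b, pdt Θ x t
        * (ρ (Θ x t) * pdx^[2] Θ x t + 1 / 2 * ρ' (Θ x t) * (pdx Θ x t) ^ 2)
      = (∫ x in a..b, ρ (Θ x t) * (pdx^[2] Θ x t) ^ 2)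
        + 1 / 2 * (∫ x in a..b, ρ' (Θ x t) * (pdx Θ x t) ^ 2 * pdx^[2] Θ x t)
        - (∫ x in a..b, f' (Θ x t) * pdx^[2] Θ x t * pdx v x t)
        - 1 / 2 * ∫ x in a..b, ρ' (Θ x t) * f (Θ x t) * (pdx Θ x t) ^ 2 * pdx v x t := by
    have h1 := hcρ.mul (hcΘ₂.pow 2)
    have h2 := ((hcρ'.mul (hcΘ₁.pow 2)).mul hcΘ₂).const_mul (1 / 2)
    have h3 := (hcf'.mul hcΘ₂).mul hcv₁
    have h4 := (((hcρ'.mul hcf).mul (hcΘ₁.pow 2)).mul hcv₁).const_mul (1 / 2)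
    rw [← intervalIntegral.integral_const_mul, ← intervalIntegral.integral_const_mul,
      ← intervalIntegral.integral_add, ← intervalIntegral.integral_sub,
      ← intervalIntegral.integral_sub]
    rotate_left
    · exact hii ((h1.add h2).sub h3)
    · exact hii h4
    · exact hii (h1.add h2)
    · exact hii h3
    · exact hii h1
    · exact hii h2
    refine intervalIntegral.integral_congr_Ioo_of_le hab.le fun x hx => ?_
    have h0 := (hf0 _ (hΘpos (Ioo_subset_Icc_self hx))).ne'
    simp only [hsol.eq_Θ x hx t ht, hρdef]
    field_simp
    ring
  have hcross : (∫ x in a..b, ρ' (Θ x t) * f (Θ x t) * (pdx Θ x t) ^ 2 * pdx v x t)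
        + (∫ x in a..b, ρ (Θ x t) * f' (Θ x t) * (pdx Θ x t) ^ 2 * pdx v x t)
        + (∫ x in a..b, f' (Θ x t) * pdx^[2] Θ x t * pdx v x t)
      = -∫ x in a..b, f' (Θ x t) * pdx Θ x t * pdx^[2] v x t := by
    have h1 := ((hcρ'.mul hcf).mul (hcΘ₁.pow 2)).mul hcv₁
    have h2 := ((hcρ.mul hcf').mul (hcΘ₁.pow 2)).mul hcv₁
    have h3 := (hcf'.mul hcΘ₂).mul hcv₁
    have hparts := integral_deriv_mul_eq_neg hab.le (p := fun x => f' (Θ x t) * pdx Θ x t)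
      (p' := fun x => f'' (Θ x t) * pdx Θ x t * pdx Θ x t + f' (Θ x t) * pdx^[2] Θ x t)
      (fun x hx => (HasDerivAt.comp (h₂ := f') (h := fun y => Θ y t) x (hf2 _ (hΘpos hx))
        (hΘd 0 (by norm_num) x hx t ht)).mul (hΘd 1 (by norm_num) x hx t ht))
      (fun x hx => hv.hv₂ x hx t ht) (((hcf''.mul hcΘ₁).mul hcΘ₁).add (hcf'.mul hcΘ₂)) hcv₂
      (by simp [hsol.bc_Θ t ht]) (by simp [hsol.bc_Θ t ht])
    rw [← hparts, ← intervalIntegral.integral_add, ← intervalIntegral.integral_add]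
    rotate_left
    · exact hii (h1.add h2)
    · exact hii h3
    · exact hii h1
    · exact hii h2
    refine intervalIntegral.integral_congr_Ioo_of_le hab.le fun x hx => ?_
    have h0 := (hf0 _ (hΘpos (Ioo_subset_Icc_self hx))).ne'
    simp only [hρdef, hρ'def]
    field_simp
    ring
  have hu₃ : ∫ x in a..b, (deriv (fun y => pdx^[2] u y t) x) ^ 2
      = ∫ x in a..b, (pdx^[3] u x t) ^ 2 := rfl
  refine (((hEv.const_mul (1 / 2)).add (hEu.const_mul (1 / 2))).add
    (hEΘ.const_mul (1 / 2))).congr_deriv ?_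
  rw [hv_expand, hΘ_expand, hv_parts, hu₃]
  linarith [hcross]
end
end

section
/- Let Ω ⊂ ℝ be an open bounded interval, let f satisfy hypothesis (F), and let the data satisfy the smooth-data hypothesis (I∞). Then there exists C > 0 such that the classical solutions (v_ε,u_ε,Θ_ε) of the regularized problems (P_ε) satisfy 1/C ≤ Θ_ε(x,t) ≤ C for all x ∈ Ω, all t > 0 and all ε ∈ (0,1). -/
open MeasureTheory Filter Set Function

noncomputable section

/-! ### Integrals depending on a time parameter -/

section Param

variable {a b : ℝ} {F F' : ℝ → ℝ → ℝ}

lemma ContinuousOn.slice (hF : ContinuousOn (uncurry F) (Icc a b ×ˢ Ici 0)) {t : ℝ} (ht : 0 ≤ t) :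
    ContinuousOn (fun x => F x t) (Icc a b) :=
  hF.comp (f := fun x => (x, t)) (by fun_prop) fun _ hx => ⟨hx, ht⟩

lemma intervalIntegrable_slice (hab : a < b) (hF : ContinuousOn (uncurry F) (Icc a b ×ˢ Ici 0))
    {t : ℝ} (ht : 0 ≤ t) : IntervalIntegrable (fun x => F x t) volume a b :=
  (hF.slice ht).intervalIntegrable_of_Icc hab.le

lemma continuousOn_integral_slice (hab : a < b)
    (hF : ContinuousOn (uncurry F) (Icc a b ×ˢ Ici 0)) :
    ContinuousOn (fun t => ∫ x in a..b, F x t) (Ici 0) := by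
  have h : Continuous (uncurry fun t x => F (max a (min b x)) (max 0 t)) :=
    hF.comp_continuous (f := fun p : ℝ × ℝ => (max a (min b p.2), max 0 p.1)) (by fun_prop)
      fun p => ⟨⟨le_max_left _ _, max_le hab.le (min_le_left _ _)⟩, le_max_left 0 p.1⟩
  refine (intervalIntegral.continuous_parametric_intervalIntegral_of_continuous'
    (μ := volume) h a b).continuousOn.congr fun t ht => ?_
  refine intervalIntegral.integral_congr fun x hx => ?_
  rw [uIcc_of_le hab.le] at hx
  simp [max_eq_right (mem_Ici.1 ht), min_eq_right hx.2, max_eq_right hx.1]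

lemma exists_bound_near (hF : ContinuousOn (uncurry F) (Icc a b ×ˢ Ici 0)) {t : ℝ} (ht : 0 < t) :
    ∃ C, ∀ x ∈ Icc a b, ∀ s ∈ Ioo (t / 2) (2 * t), |F x s| ≤ C := by
  have hK : IsCompact (Icc a b ×ˢ Icc (t / 2) (2 * t)) := isCompact_Icc.prod isCompact_Icc
  obtain ⟨C, hC⟩ := hK.exists_bound_of_continuousOn
    (hF.mono (prod_mono_right fun s hs => (half_pos ht).le.trans hs.1))
  exact ⟨C, fun x hx s hs => hC (x, s) ⟨hx, Ioo_subset_Icc_self hs⟩⟩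

lemma Ioo_half_double_mem_nhds {t : ℝ} (ht : 0 < t) : Ioo (t / 2) (2 * t) ∈ nhds t :=
  Ioo_mem_nhds (by linarith) (by linarith)

lemma hasDerivAt_integral_slice (hab : a < b)
    (hF : ContinuousOn (uncurry F) (Icc a b ×ˢ Ici 0))
    (hF' : ContinuousOn (uncurry F') (Icc a b ×ˢ Ici 0))
    (hd : ∀ x ∈ Icc a b, ∀ t ∈ Ioi (0 : ℝ), HasDerivAt (F x) (F' x t) t)
    {t : ℝ} (ht : 0 < t) :
    HasDerivAt (fun s => ∫ x in a..b, F x s) (∫ x in a..b, F' x t) t := by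
  obtain ⟨C, hC⟩ := exists_bound_near hF' ht
  have hmem : ∀ x ∈ uIoc a b, x ∈ Icc a b := fun x hx =>
    Ioc_subset_Icc_self (uIoc_of_le hab.le ▸ hx)
  refine (intervalIntegral.hasDerivAt_integral_of_dominated_loc_of_deriv_le
    (F := fun s x => F x s) (F' := fun s x => F' x s) (bound := fun _ => C)
    (Ioo_half_double_mem_nhds ht) ?_ (intervalIntegrable_slice hab hF ht.le)
    (intervalIntegrable_slice hab hF' ht.le).aestronglyMeasurable_restrict_uIoc
    (ae_of_all _ fun x hx s hs => hC x (hmem x hx) s hs) intervalIntegrable_const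
    (ae_of_all _ fun x hx s hs => hd x (hmem x hx) s ?_)).2
  · filter_upwards [Ioi_mem_nhds ht] with s hs
    exact (intervalIntegrable_slice hab hF (le_of_lt hs)).aestronglyMeasurable_restrict_uIoc
  · exact (half_pos ht).trans hs.1

/-- Product rule for `∫ (g(s) - g(t)) h(s)` at `s = t`, where `h` need only be continuous. -/
lemma hasDerivAt_integral_sub_mul (hab : a < b) {g g' h : ℝ → ℝ → ℝ}
    (hg : ContinuousOn (uncurry g) (Icc a b ×ˢ Ici 0))
    (hg' : ContinuousOn (uncurry g') (Icc a b ×ˢ Ici 0))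
    (hh : ContinuousOn (uncurry h) (Icc a b ×ˢ Ici 0))
    (hd : ∀ x ∈ Icc a b, ∀ t ∈ Ioi (0 : ℝ), HasDerivAt (g x) (g' x t) t)
    {t : ℝ} (ht : 0 < t) :
    HasDerivAt (fun s => ∫ x in a..b, (g x s - g x t) * h x s)
      (∫ x in a..b, g' x t * h x t) t := by
  obtain ⟨C, hC⟩ := exists_bound_near hg' ht
  obtain ⟨D, hD⟩ := exists_bound_near hh ht
  have hmem : ∀ x ∈ uIoc a b, x ∈ Icc a b := fun x hx =>
    Ioc_subset_Icc_self (uIoc_of_le hab.le ▸ hx)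
  have hnear : ∀ᶠ s in nhdsWithin t {t}ᶜ, s ∈ Ioo (t / 2) (2 * t) :=
    nhdsWithin_le_nhds (Ioo_half_double_mem_nhds ht)
  rw [hasDerivAt_iff_tendsto_slope]
  have key : Tendsto (fun s => ∫ x in a..b, slope (g x) t s * h x s) (nhdsWithin t {t}ᶜ)
      (nhds (∫ x in a..b, g' x t * h x t)) := by
    refine intervalIntegral.tendsto_integral_filter_of_dominated_convergence (fun _ => C * D)
      ?_ ?_ intervalIntegrable_const (ae_of_all _ fun x hx => ?_)
    · filter_upwards [hnear] with s hs
      have hs0 : 0 ≤ s := (half_pos ht).le.trans hs.1.le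
      have : ContinuousOn (fun x => slope (g x) t s * h x s) (Icc a b) := by
        simp only [slope_def_field]
        exact (((hg.slice hs0).sub (hg.slice ht.le)).div_const _).mul (hh.slice hs0)
      exact (this.intervalIntegrable_of_Icc hab.le).aestronglyMeasurable_restrict_uIoc
    · filter_upwards [hnear, self_mem_nhdsWithin] with s hs hst
      refine ae_of_all _ fun x hx => ?_
      have hx' := hmem x hx
      have htm : t ∈ Ioo (t / 2) (2 * t) := mem_of_mem_nhds (Ioo_half_double_mem_nhds ht)
      have h1 : ‖g x s - g x t‖ ≤ C * ‖s - t‖ :=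
        (convex_Ioo (t / 2) (2 * t)).norm_image_sub_le_of_norm_hasDerivWithin_le
          (fun r hr => (hd x hx' r ((half_pos ht).trans hr.1)).hasDerivWithinAt)
          (fun r hr => hC x hx' r hr) htm hs
      have hpos : 0 < |s - t| := abs_pos.2 (sub_ne_zero.2 hst)
      rw [norm_mul, slope_def_field, norm_div]
      refine mul_le_mul ?_ (hD x hx' s hs) (norm_nonneg _) ((abs_nonneg _).trans (hC x hx' t htm))
      exact (div_le_iff₀ hpos).2 h1
    · have hx' := hmem x hx
      refine Tendsto.mul (hasDerivAt_iff_tendsto_slope.1 (hd x hx' t ht)) ?_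
      have : ContinuousOn (fun s => h x s) (Ici 0) :=
        hh.comp (f := fun s => (x, s)) (by fun_prop) fun _ hs => ⟨hx', hs⟩
      exact ((this.continuousAt (Ici_mem_nhds ht)).tendsto).mono_left nhdsWithin_le_nhds
  refine key.congr fun s => ?_
  simp only [slope_def_field, sub_self, zero_mul, intervalIntegral.integral_zero, sub_zero]
  rw [← intervalIntegral.integral_div]
  congr 1
  ext x
  ring

end Param

/-! ### Differential inequalities -/

lemma le_initial_of_hasDerivAt_nonpos {y y' : ℝ → ℝ} (hc : ContinuousOn y (Ici 0))
    (hd : ∀ t, 0 < t → HasDerivAt y (y' t) t) (hle : ∀ t, 0 < t → y' t ≤ 0) {t : ℝ} (ht : 0 ≤ t) :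
    y t ≤ y 0 := by
  have h : AntitoneOn y (Ici 0) := by
    refine antitoneOn_of_deriv_nonpos (convex_Ici 0) hc ?_ ?_ <;> rw [interior_Ici]
    · exact fun s hs => (hd s hs).differentiableAt.differentiableWithinAt
    · exact fun s hs => (hd s hs).deriv ▸ hle s hs
  exact h self_mem_Ici ht ht

lemma le_of_hasDerivAt_le_of_linear_decay {y y' : ℝ → ℝ} {κ h R : ℝ} (hc : ContinuousOn y (Ici 0))
    (hd : ∀ t, 0 < t → HasDerivAt y (y' t) t) (hle : ∀ t, 0 < t → y' t ≤ -κ * y t + h)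
    (h0 : y 0 ≤ R) (hR : h ≤ κ * R) {t : ℝ} (ht : 0 ≤ t) : y t ≤ R := by
  have hexp : ∀ s, HasDerivAt (fun s => Real.exp (κ * s)) (Real.exp (κ * s) * κ) s := fun s => by
    simpa using ((hasDerivAt_id s).const_mul κ).exp
  have key := le_initial_of_hasDerivAt_nonpos (y := fun s => (y s - R) * Real.exp (κ * s))
    (y' := fun s => y' s * Real.exp (κ * s) + (y s - R) * (Real.exp (κ * s) * κ))
    ((hc.sub continuousOn_const).mul (by fun_prop))
    (fun s hs => ((hd s hs).sub_const R).mul (hexp s)) (fun s hs => ?_) ht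
  · simp only [mul_zero, Real.exp_zero, mul_one] at key
    by_contra! hlt
    have := mul_pos (sub_pos.2 hlt) (Real.exp_pos (κ * t))
    linarith
  · have e := Real.exp_pos (κ * s)
    have : y' s + κ * (y s - R) ≤ 0 := by linarith [hle s hs]
    nlinarith

/-! ### A one-dimensional interpolation inequality -/

lemma sq_integral_le {g : ℝ → ℝ} {c d : ℝ} (hcd : c ≤ d) (hg : ContinuousOn g (Icc c d)) :
    (∫ x in c..d, g x) ^ 2 ≤ (d - c) * ∫ x in c..d, g x ^ 2 := by
  rcases hcd.eq_or_lt with rfl | hlt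
  · simp
  have hi : IntervalIntegrable g volume c d := hg.intervalIntegrable_of_Icc hcd
  have hi2 : IntervalIntegrable (fun x => g x ^ 2) volume c d :=
    (hg.pow 2).intervalIntegrable_of_Icc hcd
  set I := ∫ x in c..d, g x with hI
  have hL : 0 < d - c := sub_pos.2 hlt
  have h0 : 0 ≤ ∫ x in c..d, (g x ^ 2 - (2 * (I / (d - c))) * g x + (I / (d - c)) ^ 2) :=
    intervalIntegral.integral_nonneg hcd fun x _ => by
      nlinarith [sq_nonneg (g x - I / (d - c))]
  rw [intervalIntegral.integral_add (hi2.sub (hi.const_mul _)) intervalIntegrable_const,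
    intervalIntegral.integral_sub hi2 (hi.const_mul _), intervalIntegral.integral_const_mul,
    intervalIntegral.integral_const, ← hI, smul_eq_mul] at h0
  have h1 : (∫ x in c..d, g x ^ 2) - 2 * (I / (d - c)) * I + (d - c) * (I / (d - c)) ^ 2
      = (∫ x in c..d, g x ^ 2) - I ^ 2 / (d - c) := by
    field_simp
    ring
  rw [h1, sub_nonneg, div_le_iff₀ hL] at h0
  linarith

lemma sq_le_deriv_sq_add_integral_sq {a b l : ℝ} {W W' : ℝ → ℝ} (hl : 0 < l) (hlab : l ≤ b - a)
    (hW : ∀ x ∈ Icc a b, HasDerivAt W (W' x) x) (hW' : ContinuousOn W' (Icc a b))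
    (hpos : ∀ x ∈ Icc a b, 0 ≤ W x) {x : ℝ} (hx : x ∈ Icc a b) :
    W x ^ 2 ≤ 2 * l * (∫ y in a..b, W' y ^ 2) + 2 / l ^ 2 * (∫ y in a..b, W y) ^ 2 := by
  have hab : a ≤ b := by linarith
  have hWc : ContinuousOn W (Icc a b) := fun y hy => (hW y hy).continuousAt.continuousWithinAt
  obtain ⟨c, hac, hcb, hxc⟩ : ∃ c, a ≤ c ∧ c + l ≤ b ∧ x ∈ Icc c (c + l) := by
    by_cases h : x + l ≤ b
    · exact ⟨x, hx.1, h, le_rfl, by linarith⟩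
    · exact ⟨b - l, by linarith, by linarith, by linarith, by linarith [hx.2]⟩
  have hcl : c < c + l := by linarith
  have hsub : Icc c (c + l) ⊆ Icc a b := Icc_subset_Icc hac hcb
  have hIc : ∫ y in c..c + l, W y ≤ ∫ y in a..b, W y := by
    refine intervalIntegral.integral_mono_interval hac hcl.le hcb ?_
      (hWc.intervalIntegrable_of_Icc hab)
    filter_upwards [ae_restrict_mem measurableSet_Ioc] with y hy
    exact hpos y (Ioc_subset_Icc_self hy)
  obtain ⟨y, hy, hyI⟩ : ∃ y ∈ Icc c (c + l), l * W y ≤ ∫ y in a..b, W y := by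
    by_contra! hcon
    have h := intervalIntegral.integral_mono_on (μ := volume) hcl.le
      (intervalIntegrable_const (c := (∫ y in a..b, W y) / l))
      ((hWc.mono hsub).intervalIntegrable_of_Icc hcl.le)
      (fun y hy => (div_le_iff₀' hl).2 (hcon y hy).le)
    obtain ⟨z, hz, hmin⟩ := isCompact_Icc.exists_isMinOn (nonempty_Icc.2 hcl.le) (hWc.mono hsub)
    have h' := intervalIntegral.integral_mono_on (μ := volume) hcl.le
      (intervalIntegrable_const (c := W z))
      ((hWc.mono hsub).intervalIntegrable_of_Icc hcl.le) (fun y hy => hmin hy)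
    simp only [intervalIntegral.integral_const, add_sub_cancel_left, smul_eq_mul] at h'
    linarith [hcon z hz]
  have hinc : ∀ u ∈ Icc c (c + l), ∀ w ∈ Icc c (c + l), u ≤ w →
      (W w - W u) ^ 2 ≤ l * ∫ y in a..b, W' y ^ 2 := by
    intro u hu w hw huw
    have hsub' : Icc u w ⊆ Icc a b := (Icc_subset_Icc hu.1 hw.2).trans hsub
    have hftc : ∫ y in u..w, W' y = W w - W u :=
      intervalIntegral.integral_eq_sub_of_hasDerivAt
        (fun y hy => hW y (hsub' (uIcc_of_le huw ▸ hy)))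
        ((hW'.mono hsub').intervalIntegrable_of_Icc huw)
    rw [← hftc]
    refine (sq_integral_le huw (hW'.mono hsub')).trans (mul_le_mul (by linarith [hu.1, hw.2]) ?_
      (intervalIntegral.integral_nonneg huw fun _ _ => sq_nonneg _) hl.le)
    exact intervalIntegral.integral_mono_interval (hac.trans hu.1) huw (hw.2.trans hcb)
      (ae_of_all _ fun _ => sq_nonneg _) ((hW'.pow 2).intervalIntegrable_of_Icc hab)
  have hWxy : (W x - W y) ^ 2 ≤ l * ∫ y in a..b, W' y ^ 2 := by
    rcases le_total y x with h | h
    · exact hinc y hy x hxc h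
    · have := hinc x hxc y hy h
      linarith [sq_nonneg (W x - W y), show (W x - W y) ^ 2 = (W y - W x) ^ 2 by ring]
  have hy2 : W y ^ 2 ≤ 1 / l ^ 2 * (∫ y in a..b, W y) ^ 2 := by
    have h0 : 0 ≤ l * W y := mul_nonneg hl.le (hpos y (hsub hy))
    have h1 : (l * W y) ^ 2 ≤ (∫ y in a..b, W y) ^ 2 := pow_le_pow_left₀ h0 hyI 2
    rw [one_div_mul_eq_div, le_div_iff₀ (by positivity)]
    linarith [mul_pow l (W y) 2]
  have hsplit : W x ^ 2 ≤ 2 * (W x - W y) ^ 2 + 2 * W y ^ 2 := by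
    nlinarith [sq_nonneg (W x - 2 * W y)]
  have e : 2 / l ^ 2 * (∫ y in a..b, W y) ^ 2 = 2 * (1 / l ^ 2 * (∫ y in a..b, W y) ^ 2) := by ring
  linarith

/-! ### Iteration over powers -/

lemma pow_bound_of_quadratic_recursion {m : ℕ → ℝ} {K L B : ℝ} (hK : 1 ≤ K) (hL : 1 ≤ L)
    (hB : 1 ≤ B) (hrec : ∀ k, m (k + 1) ≤ max (L * B ^ 2 ^ (k + 1)) (K * 64 ^ (k + 1) * m k ^ 2))
    (hm : ∀ k, 0 ≤ m k) :
    ∀ k, m k ≤ (K * L * 64 ^ 3 * B * (1 + m 0)) ^ 2 ^ k := by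
  set D := K * L * 64 ^ 3 * B * (1 + m 0) with hD
  have hm0 := hm 0
  suffices h : ∀ k, K * 64 ^ (k + 2) * m k ≤ D ^ 2 ^ k by
    intro k
    refine le_trans ?_ (h k)
    have : (1 : ℝ) ≤ K * 64 ^ (k + 2) := one_le_mul_of_one_le_of_one_le hK (one_le_pow₀ (by norm_num))
    nlinarith [hm k]
  have hLB : 1 ≤ L * B := one_le_mul_of_one_le_of_one_le hL hB
  intro k
  induction k with
  | zero =>
    rw [hD, pow_zero, pow_one]
    have : K * 64 ^ (0 + 2) * m 0 ≤ K * 64 ^ 3 * (L * B) * (1 + m 0) := by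
      have h1 : 1 * (1 + m 0) ≤ (L * B) * (1 + m 0) := by gcongr
      have h2 : (64 : ℝ) ^ 2 * m 0 ≤ 64 ^ 3 * ((L * B) * (1 + m 0)) := by
        norm_num
        linarith
      calc K * 64 ^ (0 + 2) * m 0 = K * (64 ^ 2 * m 0) := by ring
        _ ≤ K * (64 ^ 3 * ((L * B) * (1 + m 0))) := by gcongr
        _ = K * 64 ^ 3 * (L * B) * (1 + m 0) := by ring
    linarith
  | succ k ih =>
    have hc : 0 ≤ K * 64 ^ (k + 1 + 2) := by positivity
    refine (mul_le_mul_of_nonneg_left (hrec k) hc).trans ?_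
    rw [mul_max_of_nonneg _ _ hc]
    refine max_le ?_ ?_
    · have hn : k + 1 + 2 ≤ 3 * 2 ^ (k + 1) := by
        have := Nat.lt_two_pow_self (n := k + 1)
        omega
      have hn1 : 2 ^ (k + 1) ≠ 0 := by positivity
      calc K * 64 ^ (k + 1 + 2) * (L * B ^ 2 ^ (k + 1))
          ≤ K ^ 2 ^ (k + 1) * (64 ^ 3) ^ 2 ^ (k + 1) * (L ^ 2 ^ (k + 1) * B ^ 2 ^ (k + 1))
              * 1 ^ 2 ^ (k + 1) := by
            rw [one_pow, mul_one, ← pow_mul]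
            gcongr
            · exact le_self_pow₀ hK hn1
            · norm_num
            · exact le_self_pow₀ hL hn1
        _ ≤ K ^ 2 ^ (k + 1) * (64 ^ 3) ^ 2 ^ (k + 1) * (L ^ 2 ^ (k + 1) * B ^ 2 ^ (k + 1))
              * (1 + m 0) ^ 2 ^ (k + 1) := by
            gcongr
            linarith
        _ = D ^ 2 ^ (k + 1) := by simp only [hD, mul_pow]; ring
    · calc K * 64 ^ (k + 1 + 2) * (K * 64 ^ (k + 1) * m k ^ 2)
          = (K * 64 ^ (k + 2) * m k) ^ 2 := by ring
        _ ≤ (D ^ 2 ^ k) ^ 2 := by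
            have := hm k
            gcongr
        _ = D ^ 2 ^ (k + 1) := by rw [← pow_mul, pow_succ]

lemma le_of_integral_pow_le {a b D : ℝ} {w : ℝ → ℝ} (hab : a < b) (hw : ContinuousOn w (Icc a b))
    (hw0 : ∀ x ∈ Icc a b, 0 ≤ w x) (hD : 0 < D)
    (h : ∀ k : ℕ, ∫ x in a..b, w x ^ 2 ^ k ≤ D ^ 2 ^ k) {x : ℝ} (hx : x ∈ Icc a b) : w x ≤ D := by
  have hcl : closure (Ioo a b) = Icc a b := closure_Ioo hab.ne
  suffices hI : ∀ x ∈ Ioo a b, w x ≤ D by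
    exact le_on_closure hI (hw.mono hcl.subset) continuousOn_const (hcl ▸ hx)
  intro x hx
  by_contra! hlt
  obtain ⟨E, hDE, hEw⟩ := exists_between hlt
  have hE0 : 0 < E := hD.trans hDE
  have hev : ∀ᶠ y in nhds x, E < w y ∧ y ∈ Ioo a b :=
    ((hw.continuousAt (Icc_mem_nhds hx.1 hx.2)).eventually (lt_mem_nhds hEw)).and
      (Ioo_mem_nhds hx.1 hx.2)
  obtain ⟨δ, hδ, hball⟩ := Metric.eventually_nhds_iff_ball.1 hev
  have hsub : ∀ y ∈ Icc x (x + δ / 2), E < w y ∧ y ∈ Ioo a b := fun y hy =>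
    hball y (by rw [Metric.mem_ball, Real.dist_eq, abs_lt]; constructor <;> linarith [hy.1, hy.2])
  have hle : x ≤ x + δ / 2 := by linarith
  have hbnd : ∀ k : ℕ, δ / 2 * E ^ 2 ^ k ≤ D ^ 2 ^ k := fun k => by
    refine le_trans ?_ (h k)
    calc δ / 2 * E ^ 2 ^ k = ∫ _ in x..x + δ / 2, E ^ 2 ^ k := by simp
      _ ≤ ∫ y in x..x + δ / 2, w y ^ 2 ^ k := by
          refine intervalIntegral.integral_mono_on hle intervalIntegrable_const ?_ ?_
          · exact ((hw.mono fun y hy => Ioo_subset_Icc_self (hsub y hy).2).pow _).intervalIntegrable_of_Icc hle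
          · exact fun y hy => pow_le_pow_left₀ hE0.le (hsub y hy).1.le _
      _ ≤ ∫ y in a..b, w y ^ 2 ^ k := by
          refine intervalIntegral.integral_mono_interval hx.1.le hle
            (hsub _ (right_mem_Icc.2 hle)).2.2.le ?_ ((hw.pow _).intervalIntegrable_of_Icc hab.le)
          filter_upwards [ae_restrict_mem measurableSet_Ioc] with y hy
          exact pow_nonneg (hw0 y (Ioc_subset_Icc_self hy)) _
  have hlim : Tendsto (fun k : ℕ => (D / E) ^ 2 ^ k) atTop (nhds 0) :=
    (tendsto_pow_atTop_nhds_zero_of_lt_one (by positivity) ((div_lt_one hE0).2 hDE)).comp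
      (tendsto_pow_atTop_atTop_of_one_lt one_lt_two)
  obtain ⟨k, hk⟩ := (hlim.eventually (gt_mem_nhds (half_pos hδ))).exists
  rw [div_pow, div_lt_iff₀ (by positivity)] at hk
  linarith [hbnd k]

/-- A function `z ≥ 1` on `[a,b] × [0,∞)` all of whose power integrals obey the energy inequality
of a heat equation with a drift `v` that is bounded in `L²`, uniformly in time. -/
structure PowerEnergyIneq (a b A S B : ℝ) (z zx v : ℝ → ℝ → ℝ) : Prop where
  cont : ContinuousOn (uncurry z) (Icc a b ×ˢ Ici 0)
  cont_dx : ContinuousOn (uncurry zx) (Icc a b ×ˢ Ici 0)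
  cont_drift : ContinuousOn (uncurry v) (Icc a b ×ˢ Ici 0)
  one_le : ∀ x ∈ Icc a b, ∀ t, 0 ≤ t → 1 ≤ z x t
  hasDerivAt_dx : ∀ x ∈ Icc a b, ∀ t, 0 ≤ t → HasDerivAt (fun y => z y t) (zx x t) x
  initial_le : ∀ x ∈ Icc a b, z x 0 ≤ B
  drift_le : ∀ t, 0 ≤ t → ∫ x in a..b, v x t ^ 2 ≤ S
  energy : ∀ n : ℕ, ∃ y' : ℝ → ℝ, ∀ t, 0 < t →
    HasDerivAt (fun s => ∫ x in a..b, z x s ^ (n + 2)) (y' t) t ∧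
    y' t ≤ ∫ x in a..b, (-((n + 2 : ℝ) ^ 2 / 4) * (z x t ^ n * zx x t ^ 2)
      + A * (n + 2) ^ 2 * (z x t ^ (n + 2) * v x t ^ 2))

lemma PowerEnergyIneq.exists_step {a b A S : ℝ} (B : ℝ) (hab : a < b) (hA : 0 ≤ A) (hS : 0 ≤ S) :
    ∃ K : ℝ, 1 ≤ K ∧ ∀ z zx v, PowerEnergyIneq a b A S B z zx v → ∀ (k : ℕ) (m : ℝ),
      (∀ t, 0 ≤ t → ∫ x in a..b, z x t ^ 2 ^ k ≤ m) →
      ∀ t, 0 ≤ t → ∫ x in a..b, z x t ^ 2 ^ (k + 1) ≤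
        max (max 1 (b - a) * B ^ 2 ^ (k + 1)) (K * 64 ^ (k + 1) * m ^ 2) := by
  set L := b - a with hL
  have hL0 : 0 < L := sub_pos.2 hab
  set θ := min L (1 / (16 * A * S + 1)) with hθ
  have hc : 0 < 16 * A * S + 1 := by positivity
  have hθ0 : 0 < θ := lt_min hL0 (by positivity)
  have hθL : θ ≤ L := min_le_left _ _
  have hθA : 16 * A * S * θ ≤ 1 := by
    have h1 : θ * (16 * A * S + 1) ≤ 1 := (le_div_iff₀ hc).1 (min_le_right _ _)
    linarith
  set K₁ := 8 * A * S / θ ^ 2 + 1 / (2 * L ^ 3) with hK₁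
  have hK₁0 : 0 ≤ K₁ := by positivity
  refine ⟨1 + 4 * L ^ 2 * K₁, by nlinarith [mul_nonneg (sq_nonneg L) hK₁0], ?_⟩
  intro z zx v h k m hm
  set q := 2 ^ k with hq
  have hq1 : 1 ≤ q := Nat.one_le_two_pow
  have hqR : (1 : ℝ) ≤ q := by exact_mod_cast hq1
  obtain ⟨n, hn⟩ : ∃ n, n + 2 = 2 * q := ⟨2 * q - 2, by omega⟩
  have hnR : (n + 2 : ℝ) = 2 * q := by exact_mod_cast hn
  have hpq : 2 ^ (k + 1) = n + 2 := by rw [hn, hq, pow_succ, mul_comm]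
  obtain ⟨y', hy'⟩ := h.energy n
  rw [hpq]
  have hcz : ContinuousOn (uncurry fun x t => z x t ^ (n + 2)) (Icc a b ×ˢ Ici 0) := h.cont.pow _
  have hz0 : ∀ x ∈ Icc a b, ∀ t, 0 ≤ t → 0 ≤ z x t := fun x hx t ht =>
    zero_le_one.trans (h.one_le x hx t ht)
  have hm0 : 0 ≤ m := (intervalIntegral.integral_nonneg hab.le fun x hx =>
    pow_nonneg (hz0 x hx 0 le_rfl) q).trans (hm 0 le_rfl)
  refine fun t ht => le_of_hasDerivAt_le_of_linear_decay (κ := 1 / (4 * L ^ 2))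
    (h := K₁ * q ^ 6 * m ^ 2) (continuousOn_integral_slice hab hcz) (fun s hs => (hy' s hs).1)
    (fun s hs => ?_) ?_ ?_ ht
  · refine (hy' s hs).2.trans ?_
    set W := fun x => z x s ^ q
    set W' := fun x => q * z x s ^ (q - 1) * zx x s
    have hWd : ∀ x ∈ Icc a b, HasDerivAt W (W' x) x := fun x hx =>
      (h.hasDerivAt_dx x hx s hs.le).pow q
    have hzs := h.cont.slice hs.le
    have hzxs := h.cont_dx.slice hs.le
    have hvs := h.cont_drift.slice hs.le
    have hWc : ContinuousOn W (Icc a b) := hzs.pow q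
    have hWc' : ContinuousOn W' (Icc a b) := (continuousOn_const.mul (hzs.pow _)).mul hzxs
    have hW0 : ∀ x ∈ Icc a b, 0 ≤ W x := fun x hx => pow_nonneg (hz0 x hx s hs.le) q
    have hW2 : ∀ x, z x s ^ (n + 2) = W x ^ 2 := fun x => by
      simp only [W, ← pow_mul, hn, mul_comm]
    have hW2' : ∀ x, (n + 2 : ℝ) ^ 2 / 4 * (z x s ^ n * zx x s ^ 2) = W' x ^ 2 := fun x => by
      have : z x s ^ n = (z x s ^ (q - 1)) ^ 2 := by rw [← pow_mul]; congr 1; omega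
      simp only [W', this, hnR]
      ring
    set J := ∫ x in a..b, W' x ^ 2
    have hJ0 : 0 ≤ J := intervalIntegral.integral_nonneg hab.le fun _ _ => sq_nonneg _
    have hI0 : 0 ≤ ∫ x in a..b, W x := intervalIntegral.integral_nonneg hab.le hW0
    have hI2 : (∫ x in a..b, W x) ^ 2 ≤ m ^ 2 := pow_le_pow_left₀ hI0 (hm s hs.le) 2
    have hint : ∀ l, 0 < l → l ≤ L → ∀ x ∈ Icc a b, W x ^ 2 ≤ 2 * l * J + 2 / l ^ 2 * m ^ 2 := by
      intro l hl hlL x hx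
      refine (sq_le_deriv_sq_add_integral_sq hl hlL hWd hWc' hW0 hx).trans ?_
      gcongr
    have hi1 : IntervalIntegrable (fun x => W' x ^ 2) volume a b :=
      (hWc'.pow 2).intervalIntegrable_of_Icc hab.le
    have hi2 : IntervalIntegrable (fun x => W x ^ 2 * v x s ^ 2) volume a b :=
      ((hWc.pow 2).mul (hvs.pow 2)).intervalIntegrable_of_Icc hab.le
    have hi3 : IntervalIntegrable (fun x => W x ^ 2) volume a b :=
      (hWc.pow 2).intervalIntegrable_of_Icc hab.le
    have hi4 : IntervalIntegrable (fun x => v x s ^ 2) volume a b :=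
      (hvs.pow 2).intervalIntegrable_of_Icc hab.le
    have hsplit : ∫ x in a..b, (-((n + 2 : ℝ) ^ 2 / 4) * (z x s ^ n * zx x s ^ 2)
        + A * (n + 2) ^ 2 * (z x s ^ (n + 2) * v x s ^ 2))
        = -J + 4 * A * q ^ 2 * ∫ x in a..b, W x ^ 2 * v x s ^ 2 := by
      rw [neg_add_eq_sub, ← intervalIntegral.integral_const_mul,
        ← intervalIntegral.integral_sub (hi2.const_mul _) hi1]
      refine intervalIntegral.integral_congr fun x _ => ?_
      simp only [← hW2', hW2, hnR]
      ring
    have hWv : ∀ N, 0 ≤ N → (∀ x ∈ Icc a b, W x ^ 2 ≤ N) →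
        ∫ x in a..b, W x ^ 2 * v x s ^ 2 ≤ N * S := by
      intro N hN hWN
      calc ∫ x in a..b, W x ^ 2 * v x s ^ 2 ≤ ∫ x in a..b, N * v x s ^ 2 :=
            intervalIntegral.integral_mono_on hab.le hi2 (hi4.const_mul _) fun x hx =>
              mul_le_mul_of_nonneg_right (hWN x hx) (sq_nonneg _)
        _ = N * ∫ x in a..b, v x s ^ 2 := intervalIntegral.integral_const_mul _ _
        _ ≤ N * S := mul_le_mul_of_nonneg_left (h.drift_le s hs.le) hN
    have hl0 : 0 < θ / q ^ 2 := by positivity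
    have hlL : θ / q ^ 2 ≤ L := (div_le_self hθ0.le (one_le_pow₀ hqR)).trans hθL
    have h1 := hWv _ (by positivity) (hint _ hl0 hlL)
    have h2 : ∫ x in a..b, W x ^ 2 ≤ L * (2 * L * J + 2 / L ^ 2 * m ^ 2) := by
      have := intervalIntegral.integral_mono_on hab.le hi3 intervalIntegrable_const
        (hint L hL0 le_rfl)
      rwa [intervalIntegral.integral_const, smul_eq_mul] at this
    rw [hsplit]
    simp only [hW2]
    have h3 : 4 * A * q ^ 2 * ∫ x in a..b, W x ^ 2 * v x s ^ 2 ≤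
        J / 2 + 8 * A * S / θ ^ 2 * q ^ 6 * m ^ 2 := by
      calc 4 * A * q ^ 2 * ∫ x in a..b, W x ^ 2 * v x s ^ 2
          ≤ 4 * A * q ^ 2 * ((2 * (θ / q ^ 2) * J + 2 / (θ / q ^ 2) ^ 2 * m ^ 2) * S) := by gcongr
        _ = (16 * A * S * θ) * (J / 2) + 8 * A * S / θ ^ 2 * q ^ 6 * m ^ 2 := by
            field_simp
            ring
        _ ≤ 1 * (J / 2) + 8 * A * S / θ ^ 2 * q ^ 6 * m ^ 2 := by gcongr
        _ = _ := by ring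
    have h4 : 1 / (4 * L ^ 2) * ∫ x in a..b, W x ^ 2 ≤ J / 2 + 1 / (2 * L ^ 3) * m ^ 2 := by
      calc 1 / (4 * L ^ 2) * ∫ x in a..b, W x ^ 2
          ≤ 1 / (4 * L ^ 2) * (L * (2 * L * J + 2 / L ^ 2 * m ^ 2)) := by gcongr
        _ = _ := by
            field_simp
            ring
    have h5 : 1 / (2 * L ^ 3) * m ^ 2 ≤ 1 / (2 * L ^ 3) * q ^ 6 * m ^ 2 := by
      have h6 : 1 / (2 * L ^ 3) * m ^ 2 * 1 ≤ 1 / (2 * L ^ 3) * m ^ 2 * q ^ 6 := by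
        gcongr
        exact one_le_pow₀ hqR
      linarith
    have h7 : K₁ * q ^ 6 * m ^ 2 =
        8 * A * S / θ ^ 2 * q ^ 6 * m ^ 2 + 1 / (2 * L ^ 3) * q ^ 6 * m ^ 2 := by
      rw [hK₁]; ring
    linarith
  · refine le_max_of_le_left ?_
    have h1 : ∫ x in a..b, z x 0 ^ (n + 2) ≤ ∫ _ in a..b, B ^ (n + 2) :=
      intervalIntegral.integral_mono_on hab.le (intervalIntegrable_slice hab hcz le_rfl)
        intervalIntegrable_const fun x hx =>
          pow_le_pow_left₀ (hz0 x hx 0 le_rfl) (h.initial_le x hx) _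
    have hB : 0 ≤ B := (hz0 a (left_mem_Icc.2 hab.le) 0 le_rfl).trans
      (h.initial_le a (left_mem_Icc.2 hab.le))
    rw [intervalIntegral.integral_const, smul_eq_mul] at h1
    exact h1.trans (mul_le_mul_of_nonneg_right (le_max_right _ _) (pow_nonneg hB _))
  · have hq6 : (q : ℝ) ^ 6 = 64 ^ k := by
      rw [hq]
      push_cast
      rw [← pow_mul, mul_comm, pow_mul]
      norm_num
    calc K₁ * q ^ 6 * m ^ 2 = 1 / (4 * L ^ 2) * ((4 * L ^ 2 * K₁) * 64 ^ k * m ^ 2) := by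
          rw [hq6]
          field_simp
      _ ≤ 1 / (4 * L ^ 2) * ((1 + 4 * L ^ 2 * K₁) * 64 ^ (k + 1) * m ^ 2) := by
          gcongr
          · linarith
          · norm_num
          · exact Nat.le_succ k
      _ ≤ _ := mul_le_mul_of_nonneg_left (le_max_right _ _) (by positivity)

/-- Moser-type bound: the constant depends on `z` only through the listed quantities. -/
lemma PowerEnergyIneq.exists_bound {a b A S B I : ℝ} (hab : a < b) (hA : 0 ≤ A) (hS : 0 ≤ S)
    (hB : 1 ≤ B) (hI : 0 ≤ I) :
    ∃ D : ℝ, 0 < D ∧ ∀ z zx v, PowerEnergyIneq a b A S B z zx v →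
      (∀ t, 0 ≤ t → ∫ x in a..b, z x t ≤ I) →
      ∀ x ∈ Icc a b, ∀ t, 0 ≤ t → z x t ≤ D := by
  obtain ⟨K, hK, hstep⟩ := exists_step B hab hA hS
  set L := max 1 (b - a)
  let m : ℕ → ℝ := Nat.rec I fun k r => max (L * B ^ 2 ^ (k + 1)) (K * 64 ^ (k + 1) * r ^ 2)
  have hL : 1 ≤ L := le_max_left _ _
  have hm : ∀ k, 0 ≤ m k := by
    rintro (_ | k)
    · exact hI
    · exact le_max_of_le_left (by positivity)
  refine ⟨K * L * 64 ^ 3 * B * (1 + m 0), by have := hm 0; positivity, ?_⟩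
  intro z zx v h hz x hx t ht
  have hbound : ∀ k t, 0 ≤ t → ∫ x in a..b, z x t ^ 2 ^ k ≤ m k := by
    intro k
    induction k with
    | zero =>
      simp only [pow_zero, pow_one]
      exact hz
    | succ k ih => exact hstep z zx v h k (m k) ih
  refine le_of_integral_pow_le hab (h.cont.slice ht)
    (fun y hy => zero_le_one.trans (h.one_le y hy t ht)) (by have := hm 0; positivity)
    (fun k => ?_) hx
  exact (hbound k t ht).trans
    (pow_bound_of_quadratic_recursion hK hL hB (fun k => le_rfl) hm k)

/-! ### The nonlinearity -/

namespace HypF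

variable {f f' f'' : ℝ → ℝ}

lemma hasDerivAt (hf : HypF f f' f'') {s : ℝ} (hs : 0 < s) : HasDerivAt f (f' s) s :=
  (hf.hasDeriv₁ s hs.le).hasDerivAt (Ici_mem_nhds hs)

lemma continuousOn_deriv (hf : HypF f f' f'') : ContinuousOn f' (Ici 0) :=
  fun s hs => (hf.hasDeriv₂ s hs).continuousWithinAt

lemma continuousOn (hf : HypF f f' f'') : ContinuousOn f (Ici 0) :=
  fun s hs => (hf.hasDeriv₁ s hs).continuousWithinAt

lemma apply_pos_s13 (hf : HypF f f' f'') {s : ℝ} (hs : 0 < s) : 0 < f s := by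
  have h : StrictMonoOn f (Ici 0) := by
    refine strictMonoOn_of_deriv_pos (convex_Ici 0) hf.continuousOn fun x hx => ?_
    rw [interior_Ici] at hx
    exact (hf.hasDerivAt hx).deriv ▸ hf.pos x (Ioi_subset_Ici_self hx)
  simpa [hf.zero] using h self_mem_Ici hs.le hs

lemma exists_linear_bound (hf : HypF f f' f'') :
    ∃ M : ℝ, 0 < M ∧ (∀ s, 0 ≤ s → f' s ≤ M) ∧ ∀ s, 0 ≤ s → f s ≤ M * s := by
  obtain ⟨M, hM⟩ := hf.bdd
  refine ⟨M, (hf.pos 0 self_mem_Ici).trans_le ((le_abs_self _).trans (hM 0 self_mem_Ici).1),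
    fun s hs => (le_abs_self _).trans (hM s hs).1, fun s hs => ?_⟩
  have h := (convex_Ici (0 : ℝ)).norm_image_sub_le_of_norm_hasDerivWithin_le hf.hasDeriv₁
    (fun x hx => (hM x hx).1) self_mem_Ici hs
  rw [hf.zero, sub_zero, sub_zero, Real.norm_eq_abs, Real.norm_eq_abs, abs_of_nonneg hs] at h
  exact (le_abs_self _).trans h

end HypF

/-! ### Energy estimates for the regularized problem -/

/-- The energy of the data. -/
def dataEnergy (a b : ℝ) (v0 u0 Θ0 : ℝ → ℝ) : ℝ :=
  1 / 2 * (∫ x in a..b, v0 x ^ 2) + 1 / 2 * (∫ x in a..b, deriv u0 x ^ 2) + ∫ x in a..b, Θ0 x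

lemma hasDerivAt_pdx_iterate {w : ℝ → ℝ → ℝ} {k : ℕ} {x t : ℝ}
    (h : DifferentiableAt ℝ (fun y => pdx^[k] w y t) x) :
    HasDerivAt (fun y => pdx^[k] w y t) (pdx^[k + 1] w x t) x := by
  rw [Function.iterate_succ_apply']
  exact h.hasDerivAt

namespace IsClassicalSolEps

variable {a b ε : ℝ} {f f' f'' v0 u0 Θ0 : ℝ → ℝ} {v u Θ : ℝ → ℝ → ℝ}

lemma hasDerivAt_v (h : IsClassicalSolEps a b f ε v0 u0 Θ0 v u Θ) {k : ℕ} (hk : k < 4) {x t : ℝ}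
    (hx : x ∈ Icc a b) (ht : 0 ≤ t) :
    HasDerivAt (fun y => pdx^[k] v y t) (pdx^[k + 1] v x t) x :=
  hasDerivAt_pdx_iterate (h.diffx_v k hk x hx t ht)

lemma hasDerivAt_u (h : IsClassicalSolEps a b f ε v0 u0 Θ0 v u Θ) {k : ℕ} (hk : k < 2) {x t : ℝ}
    (hx : x ∈ Icc a b) (ht : 0 ≤ t) :
    HasDerivAt (fun y => pdx^[k] u y t) (pdx^[k + 1] u x t) x :=
  hasDerivAt_pdx_iterate (h.diffx_u k hk x hx t ht)

lemma hasDerivAt_Θ (h : IsClassicalSolEps a b f ε v0 u0 Θ0 v u Θ) {k : ℕ} (hk : k < 2) {x t : ℝ}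
    (hx : x ∈ Icc a b) (ht : 0 ≤ t) :
    HasDerivAt (fun y => pdx^[k] Θ y t) (pdx^[k + 1] Θ x t) x :=
  hasDerivAt_pdx_iterate (h.diffx_Θ k hk x hx t ht)

lemma continuousOn_comp_Θ (h : IsClassicalSolEps a b f ε v0 u0 Θ0 v u Θ) {Φ : ℝ → ℝ}
    (hΦ : ContinuousOn Φ (Ioi 0)) :
    ContinuousOn (uncurry fun x t => Φ (Θ x t)) (Icc a b ×ˢ Ici 0) :=
  hΦ.comp (h.cont_Θ 0 (Nat.zero_le _)) fun p hp => h.Θ_pos p.1 hp.1 p.2 hp.2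

lemma hasDerivAt_comp_Θ_dx (h : IsClassicalSolEps a b f ε v0 u0 Θ0 v u Θ) {Φ Φ' : ℝ → ℝ}
    (hΦ : ∀ s, 0 < s → HasDerivAt Φ (Φ' s) s) {x t : ℝ} (hx : x ∈ Icc a b) (ht : 0 ≤ t) :
    HasDerivAt (fun y => Φ (Θ y t)) (Φ' (Θ x t) * pdx^[1] Θ x t) x :=
  (hΦ _ (h.Θ_pos x hx t ht)).comp x (h.hasDerivAt_Θ (k := 0) (by norm_num) hx ht)

/-- Evolution of `∫ Φ(Θ)` for a `C²` function `Φ` on `(0,∞)`. -/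
lemma hasDerivAt_integral_comp_Θ (hab : a < b) (hf : HypF f f' f'')
    (h : IsClassicalSolEps a b f ε v0 u0 Θ0 v u Θ) {Φ Φ' Φ'' : ℝ → ℝ}
    (hΦ : ∀ s, 0 < s → HasDerivAt Φ (Φ' s) s) (hΦ' : ∀ s, 0 < s → HasDerivAt Φ' (Φ'' s) s)
    (hc : ContinuousOn Φ'' (Ioi 0)) {t : ℝ} (ht : 0 < t) :
    HasDerivAt (fun s => ∫ x in a..b, Φ (Θ x s))
      (∫ x in a..b, (-Φ'' (Θ x t) * pdx^[1] Θ x t ^ 2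
        + (Φ'' (Θ x t) * f (Θ x t) + Φ' (Θ x t) * f' (Θ x t)) * pdx^[1] Θ x t * v x t)) t := by
  have cΦ : ContinuousOn Φ (Ioi 0) := fun s hs => (hΦ s hs).continuousAt.continuousWithinAt
  have cΦ' : ContinuousOn Φ' (Ioi 0) := fun s hs => (hΦ' s hs).continuousAt.continuousWithinAt
  have c1 := (h.continuousOn_comp_Θ cΦ').slice ht.le
  have c2 := (h.continuousOn_comp_Θ hc).slice ht.le
  have c3 := (h.continuousOn_comp_Θ (hf.continuousOn.mono Ioi_subset_Ici_self)).slice ht.le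
  have c4 := (h.continuousOn_comp_Θ (hf.continuousOn_deriv.mono Ioi_subset_Ici_self)).slice ht.le
  have c5 := (h.cont_Θ 1 (by norm_num)).slice ht.le
  have c6 := (h.cont_Θ 2 le_rfl).slice ht.le
  have c7 : ContinuousOn (fun x => v x t) (Icc a b) := (h.cont_v 0 (by norm_num)).slice ht.le
  have c8 := (h.cont_v 1 (by norm_num)).slice ht.le
  have hd := hasDerivAt_integral_slice (F := fun x s => Φ (Θ x s))
    (F' := fun x s => Φ' (Θ x s) * pdt Θ x s) hab (h.continuousOn_comp_Θ cΦ)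
    ((h.continuousOn_comp_Θ cΦ').mul h.contt_Θ)
    (fun x hx s hs => (hΦ _ (h.Θ_pos x hx s (Ioi_subset_Ici_self hs))).comp s
      (h.difft_Θ x hx s (Ioi_subset_Ici_self hs)).hasDerivAt) ht
  convert hd using 1
  set R : ℝ → ℝ := fun x => -Φ'' (Θ x t) * pdx^[1] Θ x t ^ 2
        + (Φ'' (Θ x t) * f (Θ x t) + Φ' (Θ x t) * f' (Θ x t)) * pdx^[1] Θ x t * v x t with hR
  set G : ℝ → ℝ := fun x => Φ' (Θ x t) * pdx^[1] Θ x t - Φ' (Θ x t) * f (Θ x t) * v x t with hG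
  set G' : ℝ → ℝ := fun x =>
    (Φ'' (Θ x t) * pdx^[1] Θ x t * pdx^[1] Θ x t + Φ' (Θ x t) * pdx^[2] Θ x t)
    - ((Φ'' (Θ x t) * pdx^[1] Θ x t * f (Θ x t) + Φ' (Θ x t) * (f' (Θ x t) * pdx^[1] Θ x t)) * v x t
      + Φ' (Θ x t) * f (Θ x t) * pdx^[1] v x t) with hG'
  have hGd : ∀ x ∈ Icc a b, HasDerivAt G (G' x) x := fun x hx =>
    ((h.hasDerivAt_comp_Θ_dx hΦ' hx ht.le).mul (h.hasDerivAt_Θ (k := 1) (by norm_num) hx ht.le)).sub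
      (((h.hasDerivAt_comp_Θ_dx hΦ' hx ht.le).mul
        (h.hasDerivAt_comp_Θ_dx (fun s hs => hf.hasDerivAt hs) hx ht.le)).mul
        (h.hasDerivAt_v (k := 0) (by norm_num) hx ht.le))
  have iG' : IntervalIntegrable G' volume a b := ContinuousOn.intervalIntegrable_of_Icc hab.le
    ((((c2.mul c5).mul c5).add (c1.mul c6)).sub
      (((((c2.mul c5).mul c3).add (c1.mul (c4.mul c5))).mul c7).add ((c1.mul c3).mul c8)))
  have iR : IntervalIntegrable R volume a b := ContinuousOn.intervalIntegrable_of_Icc hab.le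
    ((c2.neg.mul (c5.pow 2)).add ((((c2.mul c3).add (c1.mul c4)).mul c5).mul c7))
  have h0 : ∫ x in a..b, G' x = 0 := by
    rw [intervalIntegral.integral_eq_sub_of_hasDerivAt
      (fun x hx => hGd x (uIcc_of_le hab.le ▸ hx)) iG']
    obtain ⟨ha, hb⟩ := h.bc_Θ t ht
    obtain ⟨va, vb, -, -⟩ := h.bc_v t ht
    simp only [hG, Function.iterate_one, ha, hb, va, vb, mul_zero, sub_self]
  have hsum := intervalIntegral.integral_add iR iG'
  rw [h0, add_zero] at hsum
  rw [← hsum]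
  refine intervalIntegral.integral_congr_Ioo_of_le hab.le fun x hx => ?_
  simp only [hR, hG', h.eq_Θ x hx t ht, Function.iterate_one]
  ring

/-- Evolution of `½ ∫ u_x²`, which does not require `u_x` to be differentiable in time. -/
lemma hasDerivAt_integral_pdx_u_sq (hab : a < b)
    (h : IsClassicalSolEps a b f ε v0 u0 Θ0 v u Θ) {t : ℝ} (ht : 0 < t) :
    HasDerivAt (fun s => 1 / 2 * ∫ x in a..b, pdx^[1] u x s ^ 2)
      (-∫ x in a..b, pdt u x t * pdx^[2] u x t) t := by
  have cu := h.cont_u 0 (by norm_num)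
  have cu1 := h.cont_u 1 (by norm_num)
  have cu2 := h.cont_u 2 le_rfl
  have ch : ContinuousOn (uncurry fun x s => pdx^[2] u x s + pdx^[2] u x t)
      (Icc a b ×ˢ Ici 0) := by
    refine cu2.add (((cu2.slice ht.le)).comp (f := Prod.fst) continuousOn_fst fun p hp => hp.1)
  have key := hasDerivAt_integral_sub_mul hab cu h.contt_u ch
    (fun x hx s hs => (h.difft_u x hx s (Ioi_subset_Ici_self hs)).hasDerivAt) ht
  have key2 := (key.const_mul (-(1 / 2))).const_add (1 / 2 * ∫ x in a..b, pdx^[1] u x t ^ 2)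
  have e : -(1 / 2) * (∫ x in a..b, pdt u x t * (pdx^[2] u x t + pdx^[2] u x t))
      = -∫ x in a..b, pdt u x t * pdx^[2] u x t := by
    rw [neg_mul, ← intervalIntegral.integral_const_mul]
    congr 2
    ext x
    ring
  rw [e] at key2
  refine key2.congr_of_eventuallyEq ?_
  filter_upwards [Ioi_mem_nhds ht] with s hs
  have hs0 : 0 ≤ s := le_of_lt hs
  set G : ℝ → ℝ := fun x => (u x s - u x t) * (pdx^[1] u x s + pdx^[1] u x t) with hG
  set G' : ℝ → ℝ := fun x => (pdx^[1] u x s - pdx^[1] u x t) * (pdx^[1] u x s + pdx^[1] u x t)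
    + (u x s - u x t) * (pdx^[2] u x s + pdx^[2] u x t) with hG'
  have hGd : ∀ x ∈ uIcc a b, HasDerivAt G (G' x) x := fun x hx => by
    rw [uIcc_of_le hab.le] at hx
    exact ((h.hasDerivAt_u (k := 0) (by norm_num) hx hs0).sub
      (h.hasDerivAt_u (k := 0) (by norm_num) hx ht.le)).mul
      ((h.hasDerivAt_u (k := 1) (by norm_num) hx hs0).add
      (h.hasDerivAt_u (k := 1) (by norm_num) hx ht.le))
  have d1 : ContinuousOn (fun x => u x s) (Icc a b) := cu.slice hs0
  have d2 : ContinuousOn (fun x => u x t) (Icc a b) := cu.slice ht.le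
  have d3 := cu1.slice hs0
  have d4 := cu1.slice ht.le
  have d5 := cu2.slice hs0
  have d6 := cu2.slice ht.le
  have i1 : IntervalIntegrable (fun x => pdx^[1] u x s ^ 2) volume a b :=
    (d3.pow 2).intervalIntegrable_of_Icc hab.le
  have i2 : IntervalIntegrable (fun x => pdx^[1] u x t ^ 2) volume a b :=
    (d4.pow 2).intervalIntegrable_of_Icc hab.le
  have i3 : IntervalIntegrable
      (fun x => (u x s - u x t) * (pdx^[2] u x s + pdx^[2] u x t)) volume a b :=
    ((d1.sub d2).mul (d5.add d6)).intervalIntegrable_of_Icc hab.le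
  have hGG : ∀ x, G' x = (pdx^[1] u x s ^ 2 - pdx^[1] u x t ^ 2)
      + (u x s - u x t) * (pdx^[2] u x s + pdx^[2] u x t) := fun x => by
    simp only [hG']; ring
  have hftc := intervalIntegral.integral_eq_sub_of_hasDerivAt hGd
    (by simp only [funext hGG]; exact (i1.sub i2).add i3)
  simp only [hGG] at hftc
  rw [intervalIntegral.integral_add (i1.sub i2) i3, intervalIntegral.integral_sub i1 i2] at hftc
  have hbd : G b - G a = 0 := by
    simp [hG, h.bc_u s hs, h.bc_u t ht]
  have e0 : ∀ x r, pdx^[0] u x r = u x r := fun _ _ => rfl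
  simp only [e0]
  linarith

lemma energy_le (hab : a < b) (hf : HypF f f' f'') (hε : 0 ≤ ε)
    (h : IsClassicalSolEps a b f ε v0 u0 Θ0 v u Θ) {t : ℝ} (ht : 0 ≤ t) :
    1 / 2 * (∫ x in a..b, v x t ^ 2) + 1 / 2 * (∫ x in a..b, pdx^[1] u x t ^ 2)
      + ∫ x in a..b, Θ x t ≤ dataEnergy a b v0 u0 Θ0 := by
  have cv : ContinuousOn (uncurry v) (Icc a b ×ˢ Ici 0) := h.cont_v 0 (by norm_num)
  have cΘ : ContinuousOn (uncurry Θ) (Icc a b ×ˢ Ici 0) := h.cont_Θ 0 (by norm_num)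
  have cv2 : ContinuousOn (uncurry fun x t => v x t ^ 2) (Icc a b ×ˢ Ici 0) := cv.pow 2
  have cu2 : ContinuousOn (uncurry fun x t => pdx^[1] u x t ^ 2) (Icc a b ×ˢ Ici 0) :=
    (h.cont_u 1 (by norm_num)).pow 2
  have h0 : dataEnergy a b v0 u0 Θ0 = 1 / 2 * (∫ x in a..b, v x 0 ^ 2)
      + 1 / 2 * (∫ x in a..b, pdx^[1] u x 0 ^ 2) + ∫ x in a..b, Θ x 0 := by
    rw [dataEnergy]
    congr 1
    · congr 2
      · refine intervalIntegral.integral_congr_Ioo_of_le hab.le fun x hx => ?_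
        simp only [(h.init x (Ioo_subset_Icc_self hx)).1]
      · refine intervalIntegral.integral_congr_Ioo_of_le hab.le fun x hx => ?_
        have : (fun y => u y 0) =ᶠ[nhds x] u0 := by
          filter_upwards [Ioo_mem_nhds hx.1 hx.2] with y hy
          exact (h.init y (Ioo_subset_Icc_self hy)).2.1
        simp only [Function.iterate_one, pdx, this.deriv_eq]
    · refine intervalIntegral.integral_congr_Ioo_of_le hab.le fun x hx => ?_
      exact (h.init x (Ioo_subset_Icc_self hx)).2.2.symm
  rw [h0]
  have dv : ∀ s, 0 < s → HasDerivAt (fun r => 1 / 2 * ∫ x in a..b, v x r ^ 2)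
      (1 / 2 * ∫ x in a..b, 2 * v x s * pdt v x s) s := fun s hs =>
    (hasDerivAt_integral_slice (F' := fun x s => 2 * v x s * pdt v x s) hab cv2
      (((continuousOn_const (c := (2 : ℝ))).mul cv).mul h.contt_v) (fun x hx r hr => by
        simpa [pdt] using (h.difft_v x hx r (Ioi_subset_Ici_self hr)).hasDerivAt.fun_pow 2) hs).const_mul _
  have dΘ : ∀ s, 0 < s → HasDerivAt (fun r => ∫ x in a..b, Θ x r)
      (∫ x in a..b, pdt Θ x s) s := fun s hs =>
    hasDerivAt_integral_slice hab cΘ h.contt_Θ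
      (fun x hx r hr => (h.difft_Θ x hx r (Ioi_subset_Ici_self hr)).hasDerivAt) hs
  refine le_initial_of_hasDerivAt_nonpos
    (((continuousOn_const.mul (continuousOn_integral_slice hab cv2)).add
      (continuousOn_const.mul (continuousOn_integral_slice hab cu2))).add
      (continuousOn_integral_slice hab cΘ))
    (fun s hs => ((dv s hs).add (h.hasDerivAt_integral_pdx_u_sq hab hs)).add (dΘ s hs))
    (fun s hs => ?_) ht
  have hs0 := le_of_lt hs
  have c0 : ContinuousOn (fun x => v x s) (Icc a b) := cv.slice hs0
  have c1 := (h.cont_v 1 (by norm_num)).slice hs0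
  have c2 := (h.cont_v 2 (by norm_num)).slice hs0
  have c3 := (h.cont_v 3 (by norm_num)).slice hs0
  have c4 := (h.cont_v 4 (by norm_num)).slice hs0
  have c5 : ContinuousOn (fun x => pdt v x s) (Icc a b) := h.contt_v.slice hs0
  have c6 : ContinuousOn (fun x => pdt u x s) (Icc a b) := h.contt_u.slice hs0
  have c7 : ContinuousOn (fun x => pdt Θ x s) (Icc a b) := h.contt_Θ.slice hs0
  have c8 := (h.cont_u 2 le_rfl).slice hs0
  have c9 := (h.cont_Θ 1 (by norm_num)).slice hs0
  have c10 := (h.cont_Θ 2 le_rfl).slice hs0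
  have c11 := (h.continuousOn_comp_Θ (hf.continuousOn.mono Ioi_subset_Ici_self)).slice hs0
  have c12 := (h.continuousOn_comp_Θ (hf.continuousOn_deriv.mono Ioi_subset_Ici_self)).slice hs0
  set G : ℝ → ℝ := fun x => pdx^[1] Θ x s - f (Θ x s) * v x s
    - ε * (v x s * pdx^[3] v x s - pdx^[1] v x s * pdx^[2] v x s) with hG
  set G' : ℝ → ℝ := fun x => pdx^[2] Θ x s
    - (f' (Θ x s) * pdx^[1] Θ x s * v x s + f (Θ x s) * pdx^[1] v x s)
    - ε * ((pdx^[1] v x s * pdx^[3] v x s + v x s * pdx^[4] v x s)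
      - (pdx^[2] v x s * pdx^[2] v x s + pdx^[1] v x s * pdx^[3] v x s)) with hG'
  have hGd : ∀ x ∈ uIcc a b, HasDerivAt G (G' x) x := fun x hx => by
    rw [uIcc_of_le hab.le] at hx
    have e0 := h.hasDerivAt_v (k := 0) (by norm_num) hx hs0
    have e1 := h.hasDerivAt_v (k := 1) (by norm_num) hx hs0
    have e2 := h.hasDerivAt_v (k := 2) (by norm_num) hx hs0
    have e3 := h.hasDerivAt_v (k := 3) (by norm_num) hx hs0
    exact ((h.hasDerivAt_Θ (k := 1) (by norm_num) hx hs0).sub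
      ((h.hasDerivAt_comp_Θ_dx (fun s hs => hf.hasDerivAt hs) hx hs0).mul e0)).sub
      (((e0.mul e3).sub (e1.mul e2)).const_mul ε)
  have iG' : IntervalIntegrable G' volume a b := ContinuousOn.intervalIntegrable_of_Icc hab.le
    ((c10.sub (((c12.mul c9).mul c0).add (c11.mul c1))).sub (continuousOn_const.mul
      (((c1.mul c3).add (c0.mul c4)).sub ((c2.mul c2).add (c1.mul c3)))))
  have hG0 : ∫ x in a..b, G' x = 0 := by
    rw [intervalIntegral.integral_eq_sub_of_hasDerivAt hGd iG']
    obtain ⟨ha, hb⟩ := h.bc_Θ s hs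
    obtain ⟨va, vb, wa, wb⟩ := h.bc_v s hs
    simp only [hG, Function.iterate_one, ha, hb, va, vb, wa, wb, mul_zero, zero_mul, sub_self]
  have i1 : IntervalIntegrable (fun x => 2 * v x s * pdt v x s) volume a b :=
    ((continuousOn_const.mul c0).mul c5).intervalIntegrable_of_Icc hab.le
  have i2 : IntervalIntegrable (fun x => pdt u x s * pdx^[2] u x s) volume a b :=
    (c6.mul c8).intervalIntegrable_of_Icc hab.le
  have i3 : IntervalIntegrable (fun x => pdt Θ x s) volume a b :=
    c7.intervalIntegrable_of_Icc hab.le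
  rw [← intervalIntegral.integral_const_mul, ← sub_eq_add_neg,
    ← intervalIntegral.integral_sub (i1.const_mul _) i2,
    ← intervalIntegral.integral_add ((i1.const_mul _).sub i2) i3, ← hG0]
  refine intervalIntegral.integral_mono_on_of_le_Ioo hab.le (((i1.const_mul _).sub i2).add i3)
    iG' fun x hx => ?_
  have hfx : pdx (fun y s => f (Θ y s)) x s = f' (Θ x s) * pdx^[1] Θ x s :=
    (h.hasDerivAt_comp_Θ_dx (fun s hs => hf.hasDerivAt hs) (Ioo_subset_Icc_self hx) hs0).deriv
  rw [h.eq_v x hx s hs, h.eq_u x hx s hs, h.eq_Θ x hx s hs, hfx]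
  simp only [hG', Function.iterate_one]
  nlinarith [mul_nonneg hε (sq_nonneg (pdx^[2] v x s)), mul_nonneg hε (sq_nonneg (pdx^[2] u x s))]

end IsClassicalSolEps

lemma power_dissipation_le (n : ℕ) {z d e F F' X w M : ℝ} (hz : 0 ≤ z) (he : 0 ≤ e)
    (h1 : |d * F| ≤ M * z) (h2 : |e * F + d * F'| ≤ M * |d|) :
    -((n + 2) * (n + 1) * z ^ n * d ^ 2 + (n + 2) * z ^ (n + 1) * e) * X ^ 2
      + (((n + 2) * (n + 1) * z ^ n * d ^ 2 + (n + 2) * z ^ (n + 1) * e) * F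
        + (n + 2) * z ^ (n + 1) * d * F') * X * w
      ≤ -((n + 2 : ℝ) ^ 2 / 4) * (z ^ n * (d * X) ^ 2)
        + M ^ 2 * (n + 2) ^ 2 * (z ^ (n + 2) * w ^ 2) := by
  have hn : (0 : ℝ) ≤ n := n.cast_nonneg
  have hZ : 0 ≤ z ^ n := pow_nonneg hz n
  have e1 : d * F * (d * X * w) ≤ M * z * (|d * X| * |w|) := by
    rw [← abs_mul]
    exact (le_abs_self _).trans ((abs_mul _ _).trans_le
      (mul_le_mul_of_nonneg_right h1 (abs_nonneg _)))
  have e2 : (e * F + d * F') * (X * w) ≤ M * (|d * X| * |w|) := by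
    refine (le_abs_self _).trans ((abs_mul _ _).trans_le
      ((mul_le_mul_of_nonneg_right h2 (abs_nonneg _)).trans_eq ?_))
    rw [abs_mul, abs_mul]
    ring
  have e3 : (n + 2) * (n + 1) * z ^ n * (d * F * (d * X * w))
      ≤ (n + 2) * (n + 1) * z ^ n * (M * z * (|d * X| * |w|)) :=
    mul_le_mul_of_nonneg_left e1 (by positivity)
  have e4 : (n + 2) * z ^ n * z * ((e * F + d * F') * (X * w))
      ≤ (n + 2) * z ^ n * z * (M * (|d * X| * |w|)) :=
    mul_le_mul_of_nonneg_left e2 (by positivity)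
  have e5 : 0 ≤ (n + 2) * z ^ n * z * e * X ^ 2 := by positivity
  have e6 : 0 ≤ (n + 2 : ℝ) * n / 2 * z ^ n * (d * X) ^ 2 := by positivity
  have e7 : 0 ≤ (n + 2 : ℝ) ^ 2 * z ^ n * (|d * X| / 2 - M * z * |w|) ^ 2 := by positivity
  have e8 : (n + 2 : ℝ) ^ 2 * z ^ n * (|d * X| / 2 - M * z * |w|) ^ 2
      = (n + 2 : ℝ) ^ 2 / 4 * z ^ n * (d * X) ^ 2
        - (n + 2 : ℝ) ^ 2 * z ^ n * (M * z * (|d * X| * |w|))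
        + M ^ 2 * (n + 2) ^ 2 * (z ^ n * z ^ 2 * w ^ 2) := by
    rw [← sq_abs (d * X), ← sq_abs w]
    ring
  rw [show z ^ (n + 1) = z ^ n * z from pow_succ z n, pow_add z n 2]
  generalize z ^ n = Z at *
  linarith

lemma dataEnergy_nonneg {a b : ℝ} {v0 u0 Θ0 : ℝ → ℝ} (hab : a ≤ b)
    (h : ∀ x ∈ Icc a b, 0 ≤ Θ0 x) : 0 ≤ dataEnergy a b v0 u0 Θ0 := by
  have h1 : 0 ≤ ∫ x in a..b, v0 x ^ 2 :=
    intervalIntegral.integral_nonneg hab fun _ _ => sq_nonneg _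
  have h2 : 0 ≤ ∫ x in a..b, deriv u0 x ^ 2 :=
    intervalIntegral.integral_nonneg hab fun _ _ => sq_nonneg _
  have h3 : 0 ≤ ∫ x in a..b, Θ0 x := intervalIntegral.integral_nonneg hab h
  unfold dataEnergy
  linarith

namespace IsClassicalSolEps

variable {a b ε : ℝ} {f f' f'' v0 u0 Θ0 : ℝ → ℝ} {v u Θ : ℝ → ℝ → ℝ}

lemma integral_Θ_le (hab : a < b) (hf : HypF f f' f'') (hε : 0 ≤ ε)
    (h : IsClassicalSolEps a b f ε v0 u0 Θ0 v u Θ) {t : ℝ} (ht : 0 ≤ t) :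
    ∫ x in a..b, Θ x t ≤ dataEnergy a b v0 u0 Θ0 := by
  have h1 : 0 ≤ ∫ x in a..b, v x t ^ 2 :=
    intervalIntegral.integral_nonneg hab.le fun _ _ => sq_nonneg _
  have h2 : 0 ≤ ∫ x in a..b, pdx^[1] u x t ^ 2 :=
    intervalIntegral.integral_nonneg hab.le fun _ _ => sq_nonneg _
  linarith [h.energy_le hab hf hε ht]

lemma integral_v_sq_le (hab : a < b) (hf : HypF f f' f'') (hε : 0 ≤ ε)
    (h : IsClassicalSolEps a b f ε v0 u0 Θ0 v u Θ) {t : ℝ} (ht : 0 ≤ t) :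
    ∫ x in a..b, v x t ^ 2 ≤ 2 * dataEnergy a b v0 u0 Θ0 := by
  have h1 : 0 ≤ ∫ x in a..b, Θ x t :=
    intervalIntegral.integral_nonneg hab.le fun x hx => (h.Θ_pos x hx t ht).le
  have h2 : 0 ≤ ∫ x in a..b, pdx^[1] u x t ^ 2 :=
    intervalIntegral.integral_nonneg hab.le fun _ _ => sq_nonneg _
  linarith [h.energy_le hab hf hε ht]

lemma powerEnergyIneq_comp_Θ {B M : ℝ} {φ φ' φ'' : ℝ → ℝ} {J : Set ℝ} (hab : a < b)
    (hf : HypF f f' f'') (hε : 0 ≤ ε) (h : IsClassicalSolEps a b f ε v0 u0 Θ0 v u Θ)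
    (hφ : ∀ s, 0 < s → HasDerivAt φ (φ' s) s) (hφ' : ∀ s, 0 < s → HasDerivAt φ' (φ'' s) s)
    (hc : ContinuousOn φ'' (Ioi 0)) (hJ : ∀ x ∈ Icc a b, ∀ t, 0 ≤ t → Θ x t ∈ J)
    (h1 : ∀ s ∈ J, 1 ≤ φ s) (h2 : ∀ s ∈ J, 0 ≤ φ'' s) (h3 : ∀ s ∈ J, |φ' s * f s| ≤ M * φ s)
    (h4 : ∀ s ∈ J, |φ'' s * f s + φ' s * f' s| ≤ M * |φ' s|)
    (hB : ∀ x ∈ Icc a b, φ (Θ0 x) ≤ B) :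
    PowerEnergyIneq a b (M ^ 2) (2 * dataEnergy a b v0 u0 Θ0) B (fun x t => φ (Θ x t))
      (fun x t => φ' (Θ x t) * pdx^[1] Θ x t) v := by
  have cφ : ContinuousOn φ (Ioi 0) := fun s hs => (hφ s hs).continuousAt.continuousWithinAt
  have cφ' : ContinuousOn φ' (Ioi 0) := fun s hs => (hφ' s hs).continuousAt.continuousWithinAt
  have cz := h.continuousOn_comp_Θ cφ
  have cz' := h.continuousOn_comp_Θ cφ'
  have cΘ' := h.cont_Θ 1 (by norm_num)
  have cv : ContinuousOn (uncurry v) (Icc a b ×ˢ Ici 0) := h.cont_v 0 (by norm_num)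
  refine ⟨cz, cz'.mul cΘ', cv, fun x hx t ht => h1 _ (hJ x hx t ht),
    fun x hx t ht => h.hasDerivAt_comp_Θ_dx hφ hx ht, fun x hx => ?_,
    fun t ht => h.integral_v_sq_le hab hf hε ht, fun n => ?_⟩
  · rw [(h.init x hx).2.2]
    exact hB x hx
  · have hΦ : ∀ s, 0 < s →
        HasDerivAt (fun s => φ s ^ (n + 2)) ((n + 2) * φ s ^ (n + 1) * φ' s) s := fun s hs => by
      refine ((hφ s hs).fun_pow (n + 2)).congr_deriv ?_
      push_cast
      rfl
    have hΦ' : ∀ s, 0 < s → HasDerivAt (fun s => (n + 2) * φ s ^ (n + 1) * φ' s)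
        ((n + 2) * (n + 1) * φ s ^ n * φ' s ^ 2 + (n + 2) * φ s ^ (n + 1) * φ'' s) s :=
      fun s hs => by
        refine ((((hφ s hs).fun_pow (n + 1)).const_mul (n + 2 : ℝ)).mul (hφ' s hs)).congr_deriv ?_
        push_cast
        ring
    have hΦc : ContinuousOn (fun s => (n + 2) * (n + 1) * φ s ^ n * φ' s ^ 2
        + (n + 2) * φ s ^ (n + 1) * φ'' s) (Ioi 0) :=
      ((continuousOn_const.mul (cφ.pow n)).mul (cφ'.pow 2)).add
        ((continuousOn_const.mul (cφ.pow (n + 1))).mul hc)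
    refine ⟨_, fun t ht => ⟨h.hasDerivAt_integral_comp_Θ hab hf hΦ hΦ' hΦc ht, ?_⟩⟩
    have s1 := cz.slice ht.le
    have s2 := cz'.slice ht.le
    have s4 := (h.continuousOn_comp_Θ (hf.continuousOn.mono Ioi_subset_Ici_self)).slice ht.le
    have s5 := (h.continuousOn_comp_Θ
      (hf.continuousOn_deriv.mono Ioi_subset_Ici_self)).slice ht.le
    have s6 := cΘ'.slice ht.le
    have s7 := cv.slice ht.le
    have sΦ := (h.continuousOn_comp_Θ hΦc).slice ht.le
    refine intervalIntegral.integral_mono_on hab.le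
      (ContinuousOn.intervalIntegrable_of_Icc hab.le ((sΦ.neg.mul (s6.pow 2)).add
        ((((sΦ.mul s4).add (((continuousOn_const.mul (s1.pow (n + 1))).mul s2).mul s5)).mul
          s6).mul s7)))
      (ContinuousOn.intervalIntegrable_of_Icc hab.le
        ((continuousOn_const.mul ((s1.pow n).mul ((s2.mul s6).pow 2))).add
          (continuousOn_const.mul ((s1.pow (n + 2)).mul (s7.pow 2))))) fun x hx => ?_
    have hs := hJ x hx t ht.le
    exact power_dissipation_le n (zero_le_one.trans (h1 _ hs)) (h2 _ hs) (h3 _ hs) (h4 _ hs)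

end IsClassicalSolEps

/-! ### Uniform temperature bounds -/

section Temperature

variable {a b : ℝ} {f f' f'' v0 u0 Θ0 : ℝ → ℝ}

lemma exists_temperature_le (hab : a < b) (hf : HypF f f' f'') (hdata : SmoothData a b v0 u0 Θ0) :
    ∃ D : ℝ, 0 < D ∧ ∀ ε v u Θ, 0 ≤ ε → IsClassicalSolEps a b f ε v0 u0 Θ0 v u Θ →
      ∀ x ∈ Icc a b, ∀ t, 0 ≤ t → Θ x t ≤ D := by
  obtain ⟨M, hM, hM1, hM2⟩ := hf.exists_linear_bound
  obtain ⟨B, hB⟩ := isCompact_Icc.exists_bound_of_continuousOn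
    (hdata.Θ0_smooth.continuous.continuousOn (s := Icc a b))
  have hE : 0 ≤ dataEnergy a b v0 u0 Θ0 :=
    dataEnergy_nonneg hab.le fun x hx => (hdata.Θ0_pos x hx).le
  have hL : 0 < b - a := sub_pos.2 hab
  obtain ⟨D, hD, hbound⟩ := PowerEnergyIneq.exists_bound (A := M ^ 2)
    (S := 2 * dataEnergy a b v0 u0 Θ0) (B := 1 + max 0 B) (I := dataEnergy a b v0 u0 Θ0 + (b - a))
    hab (sq_nonneg M) (by positivity) (le_add_of_nonneg_right (le_max_left _ _)) (by positivity)
  refine ⟨D, hD, fun ε v u Θ hε h x hx t ht => ?_⟩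
  have key := h.powerEnergyIneq_comp_Θ (φ := fun s => s + 1) (φ' := fun _ => 1) (φ'' := fun _ => 0)
    (J := Ioi 0) (M := M) (B := 1 + max 0 B) hab hf hε (fun s _ => (hasDerivAt_id s).add_const 1)
    (fun s _ => hasDerivAt_const s 1) continuousOn_const h.Θ_pos
    (fun s hs => le_add_of_nonneg_left (le_of_lt hs)) (fun _ _ => le_rfl) (fun s hs => ?_)
    (fun s hs => ?_) (fun y hy => ?_)
  · refine (le_add_of_nonneg_right zero_le_one).trans (hbound _ _ _ key (fun r hr => ?_) x hx t ht)
    have hi : IntervalIntegrable (fun y => Θ y r) volume a b :=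
      intervalIntegrable_slice hab (h.cont_Θ 0 (by norm_num)) hr
    rw [intervalIntegral.integral_add hi intervalIntegrable_const,
      intervalIntegral.integral_const, smul_eq_mul, mul_one]
    linarith [h.integral_Θ_le hab hf hε hr]
  · rw [one_mul, abs_of_pos (hf.apply_pos_s13 hs)]
    linarith [hM2 s (le_of_lt hs)]
  · rw [zero_mul, zero_add, one_mul, abs_one, mul_one,
      abs_of_pos (hf.pos s (Ioi_subset_Ici_self hs))]
    exact hM1 s (le_of_lt hs)
  · linarith [(le_abs_self _).trans (hB y hy), le_max_right 0 B]

lemma HypF.hasDerivAt_integral_inv (hf : HypF f f' f'') {D s : ℝ} (hD : 0 < D) (hs : 0 < s) :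
    HasDerivAt (fun s => ∫ r in s..D, (f r)⁻¹) (-(f s)⁻¹) s := by
  have hc : ContinuousOn (fun r => (f r)⁻¹) (Ioi 0) :=
    (hf.continuousOn.mono Ioi_subset_Ici_self).inv₀ fun r hr => (hf.apply_pos_s13 hr).ne'
  exact intervalIntegral.integral_hasDerivAt_left
    (hc.mono fun r hr => (lt_min hs hD).trans_le hr.1).intervalIntegrable
    (hc.stronglyMeasurableAtFilter isOpen_Ioi s hs) (hc.continuousAt (Ioi_mem_nhds hs))

lemma HypF.log_sub_log_le (hf : HypF f f' f'') {M D s : ℝ} (hM : ∀ s, 0 ≤ s → f s ≤ M * s)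
    (hs : 0 < s) (hsD : s ≤ D) : Real.log D - Real.log s ≤ M * ∫ r in s..D, (f r)⁻¹ := by
  have hD := hs.trans_le hsD
  rw [← Real.log_div hD.ne' hs.ne', ← integral_inv_of_pos hs hD,
    ← intervalIntegral.integral_const_mul]
  have hsub : Icc s D ⊆ Ioi 0 := fun r hr => hs.trans_le hr.1
  have hc : ContinuousOn (fun r => (f r)⁻¹) (Icc s D) :=
    (hf.continuousOn.mono (hsub.trans Ioi_subset_Ici_self)).inv₀
      fun r hr => (hf.apply_pos_s13 (hsub hr)).ne'
  refine intervalIntegral.integral_mono_on hsD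
    ((continuousOn_id.inv₀ fun r hr => (hsub hr).ne').intervalIntegrable_of_Icc hsD)
    ((continuousOn_const.mul hc).intervalIntegrable_of_Icc hsD) fun r hr => ?_
  have hr0 : 0 < r := hsub hr
  rw [← div_eq_mul_inv, inv_eq_one_div, div_le_div_iff₀ hr0 (hf.apply_pos_s13 hr0), one_mul]
  exact hM r hr0.le

lemma IsClassicalSolEps.entropy_le {ε D : ℝ} {v u Θ : ℝ → ℝ → ℝ} (hab : a < b)
    (hf : HypF f f' f'') (h : IsClassicalSolEps a b f ε v0 u0 Θ0 v u Θ) (hD : 0 < D) {t : ℝ}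
    (ht : 0 ≤ t) :
    ∫ x in a..b, ∫ r in Θ x t..D, (f r)⁻¹ ≤ ∫ x in a..b, ∫ r in Θ0 x..D, (f r)⁻¹ := by
  have hΦ : ∀ s, 0 < s → HasDerivAt (fun s => ∫ r in s..D, (f r)⁻¹) (-(f s)⁻¹) s :=
    fun s hs => hf.hasDerivAt_integral_inv hD hs
  have hΦ' : ∀ s, 0 < s → HasDerivAt (fun s => -(f s)⁻¹) (f' s / f s ^ 2) s := fun s hs => by
    simpa [neg_div] using ((hf.hasDerivAt hs).fun_inv (hf.apply_pos_s13 hs).ne').fun_neg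
  have hc : ContinuousOn (fun s => f' s / f s ^ 2) (Ioi 0) :=
    (hf.continuousOn_deriv.mono Ioi_subset_Ici_self).div
      ((hf.continuousOn.mono Ioi_subset_Ici_self).pow 2)
      fun s hs => pow_ne_zero 2 (hf.apply_pos_s13 hs).ne'
  have cΦ : ContinuousOn (fun s => ∫ r in s..D, (f r)⁻¹) (Ioi 0) :=
    fun s hs => (hΦ s hs).continuousAt.continuousWithinAt
  refine (le_initial_of_hasDerivAt_nonpos
    (continuousOn_integral_slice hab (h.continuousOn_comp_Θ cΦ))
    (fun s hs => h.hasDerivAt_integral_comp_Θ hab hf hΦ hΦ' hc hs) (fun s hs => ?_) ht).trans_eq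
    (intervalIntegral.integral_congr fun x hx => ?_)
  · rw [← neg_nonneg, ← intervalIntegral.integral_neg]
    refine intervalIntegral.integral_nonneg hab.le fun x hx => ?_
    have hp := h.Θ_pos x hx s (le_of_lt hs)
    have hfp := hf.apply_pos_s13 hp
    have hfp' := hf.pos _ hp.le
    have e : f' (Θ x s) / f (Θ x s) ^ 2 * f (Θ x s) + -(f (Θ x s))⁻¹ * f' (Θ x s) = 0 := by
      field_simp
      ring
    rw [e, zero_mul, zero_mul, add_zero, neg_mul, neg_neg]
    positivity
  · rw [uIcc_of_le hab.le] at hx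
    simp only [(h.init x hx).2.2]

lemma exists_le_temperature (hab : a < b) (hf : HypF f f' f'') (hdata : SmoothData a b v0 u0 Θ0) :
    ∃ c : ℝ, 0 < c ∧ ∀ ε v u Θ, 0 ≤ ε → IsClassicalSolEps a b f ε v0 u0 Θ0 v u Θ →
      ∀ x ∈ Icc a b, ∀ t, 0 ≤ t → c ≤ Θ x t := by
  obtain ⟨M, hM, hM1, hM2⟩ := hf.exists_linear_bound
  obtain ⟨D, hD, hΘD⟩ := exists_temperature_le hab hf hdata
  have hlog : ∀ {g : ℝ → ℝ}, ContinuousOn g (Icc a b) → (∀ x ∈ Icc a b, 0 < g x) →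
      ContinuousOn (fun x => 1 + (Real.log D - Real.log (g x))) (Icc a b) := fun hg hp =>
    continuousOn_const.add (continuousOn_const.sub (hg.log fun x hx => (hp x hx).ne'))
  obtain ⟨B, hB⟩ := isCompact_Icc.exists_bound_of_continuousOn
    (hlog hdata.Θ0_smooth.continuous.continuousOn hdata.Θ0_pos)
  have hE : 0 ≤ dataEnergy a b v0 u0 Θ0 :=
    dataEnergy_nonneg hab.le fun x hx => (hdata.Θ0_pos x hx).le
  obtain ⟨K, -, hbound⟩ := PowerEnergyIneq.exists_bound (A := M ^ 2)
    (S := 2 * dataEnergy a b v0 u0 Θ0) (B := max 1 B)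
    (I := max 0 ((b - a) + M * ∫ x in a..b, ∫ r in Θ0 x..D, (f r)⁻¹))
    hab (sq_nonneg M) (by positivity) (le_max_left _ _) (le_max_left _ _)
  refine ⟨Real.exp (1 + Real.log D - K), Real.exp_pos _, fun ε v u Θ hε h x hx t ht => ?_⟩
  have key := h.powerEnergyIneq_comp_Θ (φ := fun s => 1 + (Real.log D - Real.log s))
    (φ' := fun s => -s⁻¹) (φ'' := fun s => (s ^ 2)⁻¹)
    (J := Ioc 0 D) (M := M) (B := max 1 B) hab hf hε
    (fun s hs => ((Real.hasDerivAt_log hs.ne').const_sub _).const_add _)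
    (fun s hs => by simpa using (hasDerivAt_inv hs.ne').fun_neg)
    ((continuousOn_pow 2).inv₀ fun s hs => pow_ne_zero 2 (ne_of_gt hs))
    (fun y hy r hr => ⟨h.Θ_pos y hy r hr, hΘD ε v u Θ hε h y hy r hr⟩)
    (fun s hs => le_add_of_nonneg_right (sub_nonneg.2 (Real.log_le_log hs.1 hs.2)))
    (fun s _ => by positivity) (fun s hs => ?_) (fun s hs => ?_)
    (fun y hy => le_max_of_le_right ((le_abs_self _).trans (hB y hy)))
  · have hz := hbound _ _ _ key (fun r hr => ?_) x hx t ht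
    · rw [← Real.le_log_iff_exp_le (h.Θ_pos x hx t ht)]
      linarith
    · refine le_max_of_le_right ?_
      have hΦ : ContinuousOn (fun s => ∫ r in s..D, (f r)⁻¹) (Ioi 0) := fun s hs =>
        (hf.hasDerivAt_integral_inv hD hs).continuousAt.continuousWithinAt
      have i1 := intervalIntegrable_slice hab (h.continuousOn_comp_Θ hΦ) hr
      have cΘ : ContinuousOn (fun y => Θ y r) (Icc a b) := (h.cont_Θ 0 (by norm_num)).slice hr
      calc ∫ y in a..b, (1 + (Real.log D - Real.log (Θ y r)))
          ≤ ∫ y in a..b, (1 + M * ∫ r in Θ y r..D, (f r)⁻¹) :=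
            intervalIntegral.integral_mono_on hab.le
              ((hlog cΘ fun y hy => h.Θ_pos y hy r hr).intervalIntegrable_of_Icc hab.le)
              (intervalIntegrable_const.add (i1.const_mul M)) fun y hy =>
                add_le_add_right (hf.log_sub_log_le hM2 (h.Θ_pos y hy r hr)
                  (hΘD ε v u Θ hε h y hy r hr)) 1
        _ = (b - a) + M * ∫ y in a..b, ∫ r in Θ y r..D, (f r)⁻¹ := by
            rw [intervalIntegral.integral_add intervalIntegrable_const (i1.const_mul M),
              intervalIntegral.integral_const, intervalIntegral.integral_const_mul, smul_eq_mul,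
              mul_one]
        _ ≤ _ := by
            gcongr
            exact h.entropy_le hab hf hD hr
  · have hs0 := hs.1
    have h1 : s⁻¹ * f s ≤ M := by
      rw [inv_mul_le_iff₀ hs0, mul_comm]
      exact hM2 s hs0.le
    rw [neg_mul, abs_neg, abs_of_nonneg (mul_nonneg (inv_nonneg.2 hs0.le) (hf.apply_pos_s13 hs0).le)]
    have h2 := mul_nonneg hM.le (sub_nonneg.2 (Real.log_le_log hs.1 hs.2))
    linarith
  · have hs0 := hs.1
    have hi := inv_pos.2 hs0
    have h1 : s⁻¹ * f s ≤ M := by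
      rw [inv_mul_le_iff₀ hs0, mul_comm]
      exact hM2 s hs0.le
    have e : (s ^ 2)⁻¹ * f s + -s⁻¹ * f' s = (s⁻¹ * f s - f' s) * s⁻¹ := by
      rw [← inv_pow]
      ring
    rw [e, abs_mul, abs_neg]
    refine mul_le_mul_of_nonneg_right (abs_le.2 ⟨?_, ?_⟩) (abs_nonneg _)
    · linarith [hM1 s hs0.le, mul_pos hi (hf.apply_pos_s13 hs0)]
    · linarith [hf.pos s hs0.le]

end Temperature

/-- Lemma 4.4: uniform two-sided bounds for the temperature components
of the regularized problems. -/
theorem statement13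
    (a b : ℝ) (hab : a < b)
    (f f' f'' : ℝ → ℝ) (hf : HypF f f' f'')
    (v0 u0 Θ0 : ℝ → ℝ) (hdata : SmoothData a b v0 u0 Θ0)
    (v u Θ : ℝ → ℝ → ℝ → ℝ)
    (hsol : ∀ ε ∈ Ioo (0 : ℝ) 1, IsClassicalSolEps a b f ε v0 u0 Θ0 (v ε) (u ε) (Θ ε)) :
    ∃ C > (0 : ℝ), ∀ ε ∈ Ioo (0 : ℝ) 1, ∀ x ∈ Ioo a b, ∀ t ∈ Ioi (0 : ℝ),
      1 / C ≤ Θ ε x t ∧ Θ ε x t ≤ C := by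
  obtain ⟨D, hD, hle⟩ := exists_temperature_le hab hf hdata
  obtain ⟨c, hc, hge⟩ := exists_le_temperature hab hf hdata
  refine ⟨max D (1 / c), lt_max_of_lt_left hD, fun ε hε x hx t ht => ⟨?_, ?_⟩⟩
  · refine le_trans ?_ (hge ε _ _ _ hε.1.le (hsol ε hε) x (Ioo_subset_Icc_self hx) t (le_of_lt ht))
    rw [one_div_le (lt_max_of_lt_left hD) hc]
    exact le_max_right _ _
  · exact le_max_of_le_left
      (hle ε _ _ _ hε.1.le (hsol ε hε) x (Ioo_subset_Icc_self hx) t (le_of_lt ht))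
end
end
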